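/- arXiv:2201.12923 — 2 statements merged into one kernel-verified Lean document; each statement's English description precedes it below -/
import Mathlib

section
/- For a d-dimensional HKS S_0 with social network G = (V,E), n = |V|, confidence bound ε, and uniform random asynchronous agent activations, the expected number of update steps until a δ-stable state (every influence edge has length at most δ) is reached is at most n·|E|²·ε²/(2δ²). -/
open MeasureTheory
open scoped Classical ENNReal

/-- Influencing neighborhood of `v`: itself and its social-network neighbors at
distance at most `ε`. -/
noncomputable def hkNbhd {d : ℕ} {V : Type*} [Fintype V] [DecidableEq V]
    (G : SimpleGraph V) (ε : ℝ) (x : V → EuclideanSpace ℝ (Fin d)) (v : V) :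
    Finset V :=
  insert v (Finset.univ.filter (fun u => G.Adj u v ∧ ‖x u - x v‖ ≤ ε))

/-- HK update: agent `v` adopts the average opinion of its influencing
neighborhood. -/
noncomputable def hkStep {d : ℕ} {V : Type*} [Fintype V] [DecidableEq V]
    (G : SimpleGraph V) (ε : ℝ) (x : V → EuclideanSpace ℝ (Fin d)) (v : V) :
    V → EuclideanSpace ℝ (Fin d) :=
  Function.update x v (((hkNbhd G ε x v).card : ℝ)⁻¹ • ∑ u ∈ hkNbhd G ε x v, x u)

/-- Trajectory of the asynchronous HK dynamics under activation sequence `σ`. -/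
noncomputable def hkTraj {d : ℕ} {V : Type*} [Fintype V] [DecidableEq V]
    (G : SimpleGraph V) (ε : ℝ) (x0 : V → EuclideanSpace ℝ (Fin d))
    (σ : ℕ → V) : ℕ → V → EuclideanSpace ℝ (Fin d)
  | 0 => x0
  | t + 1 => hkStep G ε (hkTraj G ε x0 σ t) (σ t)

/-- A state is `δ`-stable if every influence edge (social edge of length at most
`ε`) has length at most `δ`. -/
def hkStable {d : ℕ} {V : Type*} (G : SimpleGraph V) (ε δ : ℝ)
    (x : V → EuclideanSpace ℝ (Fin d)) : Prop :=
  ∀ u w : V, G.Adj u w → ‖x u - x w‖ ≤ ε → ‖x u - x w‖ ≤ δ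

open scoped ZMod ComplexConjugate in
theorem ZMod.sum_normSq_dft {N : ℕ} [NeZero N] (a : ZMod N → ℂ) :
    ∑ k, ‖ZMod.dft a k‖ ^ 2 = N * ∑ j, ‖a j‖ ^ 2 := by
  have hconj : ∀ k, conj (𝓕 a k) = ∑ j, ZMod.stdAddChar (j * k) * conj (a j) := by
    intro k
    rw [ZMod.dft_apply, map_sum]
    refine Finset.sum_congr rfl fun j _ => ?_
    rw [smul_eq_mul, map_mul, AddChar.map_neg_eq_conj, Complex.conj_conj]
  have key : ∑ k, 𝓕 a k * conj (𝓕 a k) = N * ∑ j, a j * conj (a j) := by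
    simp_rw [hconj, Finset.mul_sum]
    rw [Finset.sum_comm]
    refine Finset.sum_congr rfl fun j _ => ?_
    have h := congrFun (ZMod.dft_dft a) (-j)
    rw [ZMod.dft_apply] at h
    simp only [neg_neg, smul_eq_mul, mul_neg] at h
    rw [← mul_assoc, ← h, Finset.sum_mul]
    refine Finset.sum_congr rfl fun k _ => ?_
    rw [mul_comm j k]; ring
  simp_rw [Complex.mul_conj, Complex.normSq_eq_norm_sq] at key
  exact_mod_cast key

open scoped ZMod in
theorem ZMod.dft_shift {N : ℕ} [NeZero N] (a : ZMod N → ℂ) (k : ZMod N) :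
    ZMod.dft (fun j => a (j + 1)) k = ZMod.stdAddChar k * ZMod.dft a k := by
  rw [ZMod.dft_apply, ZMod.dft_apply, Finset.mul_sum]
  refine Fintype.sum_equiv (Equiv.addRight 1) _ _ fun j => ?_
  simp only [Equiv.coe_addRight, smul_eq_mul]
  rw [← mul_assoc, ← AddChar.map_add_eq_mul]
  congr 2
  ring

theorem ZMod.two_sin_le_norm_stdAddChar_sub_one {N : ℕ} [NeZero N] {k : ZMod N} (hk : k ≠ 0) :
    2 * Real.sin (Real.pi / N) ≤ ‖ZMod.stdAddChar k - 1‖ := by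
  have hN : (0 : ℝ) < N := by exact_mod_cast Nat.pos_of_ne_zero (NeZero.ne N)
  have hv1 : (1 : ℝ) ≤ k.val := by
    exact_mod_cast Nat.one_le_iff_ne_zero.2 (by rwa [Ne, ZMod.val_eq_zero])
  have hv2 : (k.val : ℝ) + 1 ≤ N := by exact_mod_cast ZMod.val_lt k
  have h1 : (ZMod.stdAddChar k : ℂ)
      = Complex.exp (Complex.I * ((2 * Real.pi * k.val / N : ℝ) : ℂ)) := by
    rw [ZMod.stdAddChar_apply, ZMod.toCircle_apply]
    congr 1
    push_cast
    ring
  rw [h1, Complex.norm_exp_I_mul_ofReal_sub_one, Real.norm_eq_abs]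
  refine le_trans ?_ (le_abs_self _)
  have h2 : 2 * Real.pi * k.val / N / 2 = Real.pi * k.val / N := by ring
  rw [h2]
  have hpi := Real.pi_pos
  have hx : Real.pi / N ≤ Real.pi * k.val / N := by
    gcongr
    nlinarith
  have hy : Real.pi * k.val / N ≤ Real.pi - Real.pi / N := by
    rw [div_le_iff₀ hN, sub_mul, div_mul_cancel₀ _ hN.ne']
    nlinarith
  have h0 : 0 < Real.pi / N := by positivity
  have : Real.sin (Real.pi / N) ≤ Real.sin (Real.pi * k.val / N) := by
    rcases le_total (Real.pi * k.val / N) (Real.pi / 2) with h | h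
    · exact Real.sin_le_sin_of_le_of_le_pi_div_two (by linarith) h hx
    · rw [← Real.sin_pi_sub (Real.pi * k.val / N)]
      exact Real.sin_le_sin_of_le_of_le_pi_div_two (by linarith) (by linarith) (by linarith)
  linarith

theorem ZMod.wirtinger_complex {N : ℕ} [NeZero N] (a : ZMod N → ℂ) (ha : ∑ j, a j = 0) :
    4 * Real.sin (Real.pi / N) ^ 2 * ∑ j, ‖a j‖ ^ 2 ≤ ∑ j, ‖a (j + 1) - a j‖ ^ 2 := by
  have hN : (0 : ℝ) < N := by exact_mod_cast Nat.pos_of_ne_zero (NeZero.ne N)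
  refine le_of_mul_le_mul_left ?_ hN
  rw [← ZMod.sum_normSq_dft (fun j => a (j + 1) - a j), mul_left_comm, ← ZMod.sum_normSq_dft,
    Finset.mul_sum]
  refine Finset.sum_le_sum fun k _ => ?_
  have h : ZMod.dft (fun j => a (j + 1) - a j) k = (ZMod.stdAddChar k - 1) * ZMod.dft a k := by
    have := ZMod.dft_shift a k
    have h2 : (fun j => a (j + 1) - a j) = (fun j => a (j + 1)) - a := rfl
    rw [h2, map_sub, Pi.sub_apply, this]
    ring
  rw [h, norm_mul, mul_pow]
  by_cases hk : k = 0
  · subst hk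
    rw [ZMod.dft_apply_zero, ha]
    simp
  · have h1 := ZMod.two_sin_le_norm_stdAddChar_sub_one hk
    have h0 : 0 ≤ Real.sin (Real.pi / N) :=
      Real.sin_nonneg_of_nonneg_of_le_pi (by positivity)
        (div_le_self Real.pi_pos.le (by
          exact_mod_cast Nat.one_le_iff_ne_zero.2 (NeZero.ne N)))
    gcongr
    nlinarith

theorem ZMod.wirtinger {N d : ℕ} [NeZero N] (z : ZMod N → EuclideanSpace ℝ (Fin d)) :
    ∃ c, 4 * Real.sin (Real.pi / N) ^ 2 * ∑ j, ‖z j - c‖ ^ 2 ≤ ∑ j, ‖z (j + 1) - z j‖ ^ 2 := by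
  have hN : (N : ℝ) ≠ 0 := by exact_mod_cast NeZero.ne N
  refine ⟨(N : ℝ)⁻¹ • ∑ j, z j, ?_⟩
  simp_rw [EuclideanSpace.norm_sq_eq]
  rw [Finset.sum_comm, Finset.sum_comm (f := fun j i => ‖(z (j + 1) - z j) i‖ ^ 2),
    Finset.mul_sum]
  refine Finset.sum_le_sum fun i _ => ?_
  have := ZMod.wirtinger_complex (fun j => (((z j - (N : ℝ)⁻¹ • ∑ j, z j) i : ℝ) : ℂ)) (by
    rw [← Complex.ofReal_sum]
    simp only [PiLp.sub_apply, PiLp.smul_apply, WithLp.ofLp_sum, Finset.sum_apply,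
      Finset.sum_sub_distrib, Finset.sum_const, Finset.card_univ, ZMod.card, nsmul_eq_mul,
      smul_eq_mul]
    rw [mul_inv_cancel_left₀ hN, sub_self, Complex.ofReal_zero])
  simp only [← Complex.ofReal_sub, Complex.norm_real] at this
  refine this.trans_eq (Finset.sum_congr rfl fun j _ => ?_)
  simp

theorem wirtinger_closed {N d : ℕ} (hN : 0 < N) (z : ℕ → EuclideanSpace ℝ (Fin d))
    (hz : z N = z 0) :
    ∃ c, 4 * Real.sin (Real.pi / N) ^ 2 * ∑ i ∈ Finset.range N, ‖z i - c‖ ^ 2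
      ≤ ∑ i ∈ Finset.range N, ‖z (i + 1) - z i‖ ^ 2 := by
  obtain ⟨M, rfl⟩ : ∃ M, N = M + 1 := ⟨N - 1, by omega⟩
  obtain ⟨c, hc⟩ := ZMod.wirtinger (fun j : ZMod (M + 1) => z j.val)
  refine ⟨c, ?_⟩
  rw [Finset.sum_range, Finset.sum_range]
  have h2 : ∀ j : ZMod (M + 1), z (j + 1).val = z (j.val + 1) := by
    intro j
    rcases Nat.lt_or_ge (j.val + 1) (M + 1) with h | h
    · rw [ZMod.val_add, ZMod.val_one_eq_one_mod, Nat.add_mod_mod, Nat.mod_eq_of_lt h]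
    · have h3 : j.val = M := by have := ZMod.val_lt j; omega
      have h4 : (j + 1) = 0 := by
        rw [← ZMod.natCast_zmod_val j, h3]
        exact_mod_cast ZMod.natCast_self (M + 1)
      rw [h4, h3, ZMod.val_zero, hz]
  simp only [h2] at hc
  exact hc
namespace SimpleGraph

theorem Walk.sum_darts_eq_sum_getVert {V : Type*} {H : SimpleGraph V} (ψ : V → V → ℝ) {a b : V}
    (p : H.Walk a b) :
    (p.darts.map fun e => ψ e.fst e.snd).sum
      = ∑ i ∈ Finset.range p.length, ψ (p.getVert i) (p.getVert (i + 1)) := by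
  induction p with
  | nil => simp
  | cons h p ih =>
    rw [Walk.length_cons, Finset.sum_range_succ']
    simp only [Walk.darts_cons, List.map_cons, List.sum_cons, ih, Walk.getVert_cons_succ,
      Walk.getVert_zero]
    rw [add_comm]

/-- A closed walk traversing a set of darts closed under reversal, each at most once. -/
def Walk.IsDoubled {V : Type*} {H : SimpleGraph V} {a : V} (p : H.Walk a a) : Prop :=
  p.darts.Nodup ∧ (∀ e ∈ p.darts, e.symm ∈ p.darts) ∧ Even p.length ∧
    2 * p.support.toFinset.card ≤ p.length + 2

theorem Walk.IsDoubled.exists_insert {V : Type*} {H : SimpleGraph V} {a : V} {p : H.Walk a a}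
    (hp : p.IsDoubled) {u v : V} (hu : u ∈ p.support) (h : H.Adj u v)
    (hd : (⟨(u, v), h⟩ : H.Dart) ∉ p.darts) :
    ∃ q : H.Walk a a, q.IsDoubled ∧ q.length = p.length + 2 := by
  obtain ⟨h1, h2, h3, h4⟩ := hp
  let e : H.Dart := ⟨(u, v), h⟩
  let q : H.Walk a a :=
    (p.takeUntil u hu).append (Walk.cons h (Walk.cons h.symm (p.dropUntil u hu)))
  have hspec := p.take_spec hu
  have hpd : p.darts = (p.takeUntil u hu).darts ++ (p.dropUntil u hu).darts := by
    conv_lhs => rw [← hspec, Walk.darts_append]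
  have hqd : q.darts = (p.takeUntil u hu).darts ++ e :: e.symm :: (p.dropUntil u hu).darts := by
    simp only [q, Walk.darts_append, Walk.darts_cons]
    rfl
  have hperm : q.darts.Perm (e :: e.symm :: p.darts) := by
    rw [hqd, hpd]
    refine List.perm_middle.trans (List.Perm.cons _ List.perm_middle)
  have hlen : q.length = p.length + 2 := by
    rw [← Walk.length_darts, hperm.length_eq]
    simp
  have hsymm : e.symm ∉ p.darts := fun hh => hd (by simpa using h2 _ hh)
  refine ⟨q, ⟨?_, ?_, ?_, ?_⟩, hlen⟩
  · rw [hperm.nodup_iff, List.nodup_cons, List.nodup_cons]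
    refine ⟨?_, hsymm, h1⟩
    rw [List.mem_cons, not_or]
    exact ⟨fun hh => e.symm_ne hh.symm, hd⟩
  · intro f hf
    rw [hperm.mem_iff, List.mem_cons, List.mem_cons] at hf ⊢
    rcases hf with rfl | rfl | hf
    · simp
    · simp
    · exact Or.inr (Or.inr (h2 f hf))
  · rw [hlen]; exact h3.add (by decide)
  · have hsub : q.support.toFinset ⊆ insert v p.support.toFinset := by
      intro w hw
      simp only [q, List.mem_toFinset, Walk.mem_support_append_iff, Walk.support_cons,
        List.mem_cons, Finset.mem_insert] at hw ⊢
      rcases hw with hw | hw | hw | hw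
      · exact Or.inr (p.support_takeUntil_subset_support hu hw)
      · exact Or.inr (hw ▸ hu)
      · exact Or.inl hw
      · exact Or.inr (p.support_dropUntil_subset_support hu hw)
    have := (Finset.card_le_card hsub).trans (Finset.card_insert_le _ _)
    omega

theorem exists_isDoubled_full {V : Type*} [Fintype V] (H : SimpleGraph V) (a : V) :
    ∃ p : H.Walk a a, p.IsDoubled ∧
      ∀ u ∈ p.support, ∀ v, ∀ h : H.Adj u v, (⟨(u, v), h⟩ : H.Dart) ∈ p.darts := by
  by_contra! hcon
  have key : ∀ k : ℕ, ∃ p : H.Walk a a, p.IsDoubled ∧ k ≤ p.length := by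
    intro k
    induction k with
    | zero => exact ⟨Walk.nil, by simp [Walk.IsDoubled], by simp⟩
    | succ k ih =>
      obtain ⟨p, hp, hk⟩ := ih
      obtain ⟨u, hu, v, h, hd⟩ := hcon p hp
      obtain ⟨q, hq, hl⟩ := hp.exists_insert hu h hd
      exact ⟨q, hq, by omega⟩
  obtain ⟨p, hp, hk⟩ := key (Fintype.card H.Dart + 1)
  have := hp.1.length_le_card
  rw [Walk.length_darts] at this
  omega

/-- The component of `a` is covered by a closed sequence traversing every edge once in each
direction. -/
theorem exists_double_tour {V : Type*} [Fintype V] (H : SimpleGraph V) (a : V) :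
    ∃ (X : Finset V) (m : ℕ) (z : ℕ → V), a ∈ X ∧ (∀ u ∈ X, ∀ v, H.Adj u v → v ∈ X) ∧
      X.card ≤ m + 1 ∧ z (2 * m) = z 0 ∧
      ∀ ψ : V → V → ℝ, ∑ i ∈ Finset.range (2 * m), ψ (z i) (z (i + 1))
        = ∑ u ∈ X, ∑ v, if H.Adj u v then ψ u v else 0 := by
  obtain ⟨p, ⟨h1, h2, ⟨m, h3⟩, h4⟩, hfull⟩ := H.exists_isDoubled_full a
  have h3' : p.length = 2 * m := by omega
  refine ⟨p.support.toFinset, m, p.getVert, by simp, ?_, by omega, ?_, ?_⟩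
  · intro u hu v h
    rw [List.mem_toFinset] at hu ⊢
    exact p.dart_snd_mem_support_of_mem_darts (hfull u hu v h)
  · rw [← h3', Walk.getVert_length, Walk.getVert_zero]
  · intro ψ
    rw [← h3', ← Walk.sum_darts_eq_sum_getVert, ← List.sum_toFinset _ h1, ← Finset.sum_product',
      ← Finset.sum_filter]
    refine Finset.sum_bij (fun e _ => e.toProd) ?_ ?_ ?_ ?_
    · intro e he
      rw [List.mem_toFinset] at he
      rw [Finset.mem_filter, Finset.mem_product, List.mem_toFinset]
      exact ⟨⟨p.dart_fst_mem_support_of_mem_darts he, Finset.mem_univ _⟩, e.adj⟩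
    · intro e _ f _ hef
      exact Dart.ext _ _ hef
    · rintro ⟨u, v⟩ huv
      simp only [Finset.mem_filter, Finset.mem_product, List.mem_toFinset] at huv
      exact ⟨⟨(u, v), huv.2⟩, by rw [List.mem_toFinset]; exact hfull u huv.1.1 v huv.2, rfl⟩
    · intro e _
      rfl

end SimpleGraph

section Potential

variable {d : ℕ} {V : Type*} [Fintype V]

/-- The potential: half the sum of `min (‖x u - x w‖²) ε²` over ordered adjacent pairs. -/
noncomputable def hkPot (G : SimpleGraph V) (ε : ℝ) (x : V → EuclideanSpace ℝ (Fin d)) : ℝ :=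
  (∑ u, ∑ w, if G.Adj u w then min (‖x u - x w‖ ^ 2) (ε ^ 2) else 0) / 2

/-- The influence network of a state. -/
def hkInf (G : SimpleGraph V) (ε : ℝ) (x : V → EuclideanSpace ℝ (Fin d)) : SimpleGraph V where
  Adj u v := G.Adj u v ∧ ‖x u - x v‖ ≤ ε
  symm := ⟨fun u v h => ⟨h.1.symm, by rw [norm_sub_rev]; exact h.2⟩⟩
  loopless := ⟨fun u h => G.loopless.irrefl u h.1⟩

/-- The degree of `v` in the influence network. -/
noncomputable def hkDeg (G : SimpleGraph V) (ε : ℝ) (x : V → EuclideanSpace ℝ (Fin d)) (v : V) :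
    ℝ :=
  ∑ u, if (hkInf G ε x).Adj v u then 1 else 0

/-- The total displacement of `v` from its influencing neighbours. -/
noncomputable def hkForce (G : SimpleGraph V) (ε : ℝ) (x : V → EuclideanSpace ℝ (Fin d)) (v : V) :
    EuclideanSpace ℝ (Fin d) :=
  ∑ u, if (hkInf G ε x).Adj v u then x v - x u else 0

theorem hkDeg_nonneg (G : SimpleGraph V) (ε : ℝ) (x : V → EuclideanSpace ℝ (Fin d)) (v : V) :
    0 ≤ hkDeg G ε x v :=
  Finset.sum_nonneg fun _ _ => by split_ifs <;> norm_num

theorem hkStep_eq [DecidableEq V] (G : SimpleGraph V) (ε : ℝ)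
    (x : V → EuclideanSpace ℝ (Fin d)) (v : V) :
    hkStep G ε x v
      = Function.update x v (x v - (hkDeg G ε x v + 1)⁻¹ • hkForce G ε x v) := by
  unfold hkStep
  congr 1
  set S := Finset.univ.filter (fun u => G.Adj u v ∧ ‖x u - x v‖ ≤ ε) with hS
  have hSmem : ∀ u, (hkInf G ε x).Adj v u ↔ u ∈ S := by
    intro u
    rw [(hkInf G ε x).adj_comm]
    simp [hS, hkInf]
  have hv : v ∉ S := by simp [hS]
  have hdeg : hkDeg G ε x v = S.card := by
    simp only [hkDeg, hSmem]
    simp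
  have hforce : hkForce G ε x v = (S.card : ℝ) • x v - ∑ u ∈ S, x u := by
    simp only [hkForce, hSmem]
    rw [Finset.sum_ite_mem, Finset.univ_inter, Finset.sum_sub_distrib, Finset.sum_const,
      Nat.cast_smul_eq_nsmul]
  have hN : hkNbhd G ε x v = insert v S := by
    unfold hkNbhd
    congr
  have hc : (S.card : ℝ) + 1 ≠ 0 := by positivity
  rw [hN, Finset.card_insert_of_notMem hv, Finset.sum_insert hv, hdeg, hforce]
  push_cast
  rw [inv_smul_eq_iff₀ hc, smul_sub, smul_inv_smul₀ hc, add_smul, one_smul]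
  abel

theorem hkPot_sub_update [DecidableEq V] (G : SimpleGraph V) (ε : ℝ)
    (x : V → EuclideanSpace ℝ (Fin d)) (v : V) (y : EuclideanSpace ℝ (Fin d)) :
    hkPot G ε x - hkPot G ε (Function.update x v y)
      = ∑ w, if G.Adj v w then min (‖x v - x w‖ ^ 2) (ε ^ 2) - min (‖y - x w‖ ^ 2) (ε ^ 2)
          else 0 := by
  set g : V → ℝ := fun w => if G.Adj v w then
    min (‖x v - x w‖ ^ 2) (ε ^ 2) - min (‖y - x w‖ ^ 2) (ε ^ 2) else 0 with hg
  have key : ∀ u w, (if G.Adj u w then min (‖x u - x w‖ ^ 2) (ε ^ 2) else 0)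
      - (if G.Adj u w then min (‖Function.update x v y u - Function.update x v y w‖ ^ 2) (ε ^ 2)
        else 0)
      = (if u = v then g w else 0) + if w = v then g u else 0 := by
    intro u w
    simp only [hg]
    by_cases hu : u = v
    · subst hu
      by_cases hw : w = u
      · subst hw; simp
      · simp only [hw, if_true, if_false, Function.update_self, Function.update_of_ne hw,
          add_zero]
        split_ifs <;> simp
    · by_cases hw : w = v
      · subst hw
        simp only [hu, if_true, if_false, Function.update_self,
          Function.update_of_ne hu, zero_add, G.adj_comm u w, norm_sub_rev (x u) (x w),
          norm_sub_rev (x u) y]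
        split_ifs <;> simp
      · simp [hu, hw]
  unfold hkPot
  rw [← sub_div, ← Finset.sum_sub_distrib]
  simp_rw [← Finset.sum_sub_distrib, key, Finset.sum_add_distrib]
  rw [Finset.sum_comm]
  simp only [Finset.sum_ite_eq', Finset.mem_univ, if_true]
  ring

theorem hkPot_drop [DecidableEq V] (G : SimpleGraph V) {ε : ℝ} (hε : 0 < ε)
    (x : V → EuclideanSpace ℝ (Fin d)) (v : V) :
    (hkDeg G ε x v + 2) / (hkDeg G ε x v + 1) ^ 2 * ‖hkForce G ε x v‖ ^ 2
      ≤ hkPot G ε x - hkPot G ε (hkStep G ε x v) := by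
  rw [hkStep_eq, hkPot_sub_update]
  set D := hkDeg G ε x v with hD
  set f := hkForce G ε x v with hf
  have hD0 : 0 ≤ D := hkDeg_nonneg G ε x v
  set h := (D + 1)⁻¹ • f with hh
  have h1 : ∑ w, (if (hkInf G ε x).Adj v w then ‖x v - x w‖ ^ 2 - ‖x v - h - x w‖ ^ 2 else 0)
      = 2 * inner ℝ f h - D * ‖h‖ ^ 2 := by
    have : ∀ w, (if (hkInf G ε x).Adj v w then ‖x v - x w‖ ^ 2 - ‖x v - h - x w‖ ^ 2 else 0)
        = 2 * inner ℝ (if (hkInf G ε x).Adj v w then x v - x w else 0) h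
          - (if (hkInf G ε x).Adj v w then 1 else 0) * ‖h‖ ^ 2 := by
      intro w
      split_ifs
      · have : x v - h - x w = (x v - x w) - h := by abel
        rw [this, norm_sub_sq_real (x v - x w) h]
        ring
      · simp
    simp_rw [this]
    rw [Finset.sum_sub_distrib, ← Finset.mul_sum, ← sum_inner, ← Finset.sum_mul]
    rfl
  have h2 : 2 * inner ℝ f h - D * ‖h‖ ^ 2 = (D + 2) / (D + 1) ^ 2 * ‖f‖ ^ 2 := by
    rw [hh, inner_smul_right, real_inner_self_eq_norm_sq, norm_smul, Real.norm_eq_abs, mul_pow,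
      sq_abs]
    field_simp
    ring
  rw [← h2, ← h1]
  refine Finset.sum_le_sum fun w _ => ?_
  by_cases hG : G.Adj v w
  · rw [if_pos hG]
    by_cases hn : ‖x v - x w‖ ≤ ε
    · rw [if_pos (show (hkInf G ε x).Adj v w from ⟨hG, hn⟩)]
      have : ‖x v - x w‖ ^ 2 ≤ ε ^ 2 := pow_le_pow_left₀ (norm_nonneg _) hn 2
      rw [min_eq_left this]
      linarith [min_le_left (‖x v - h - x w‖ ^ 2) (ε ^ 2)]
    · rw [if_neg (show ¬ (hkInf G ε x).Adj v w from fun hh => hn hh.2)]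
      have : ε ^ 2 ≤ ‖x v - x w‖ ^ 2 := pow_le_pow_left₀ hε.le (not_le.1 hn).le 2
      rw [min_eq_right this]
      linarith [min_le_right (‖x v - h - x w‖ ^ 2) (ε ^ 2)]
  · rw [if_neg hG, if_neg (show ¬ (hkInf G ε x).Adj v w from fun hh => hG hh.1)]

theorem hkForce_eq_zero_or (G : SimpleGraph V) (ε : ℝ) (x : V → EuclideanSpace ℝ (Fin d)) (v : V) :
    hkForce G ε x v = 0 ∨ 1 ≤ hkDeg G ε x v := by
  by_cases h : ∃ u, (hkInf G ε x).Adj v u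
  · obtain ⟨u, hu⟩ := h
    right
    refine le_trans (le_of_eq ?_) (Finset.single_le_sum (f := fun u =>
      if (hkInf G ε x).Adj v u then (1 : ℝ) else 0) (fun i _ => ?_) (Finset.mem_univ u))
    · simp [hu]
    · split_ifs <;> norm_num
  · left
    push Not at h
    exact Finset.sum_eq_zero fun u _ => if_neg (h u)

/-- The total potential drop over all agents. -/
noncomputable def hkDrop [DecidableEq V] (G : SimpleGraph V) (ε : ℝ)
    (x : V → EuclideanSpace ℝ (Fin d)) : ℝ :=
  ∑ v, (hkPot G ε x - hkPot G ε (hkStep G ε x v))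

theorem hkPot_step_le [DecidableEq V] (G : SimpleGraph V) {ε : ℝ} (hε : 0 < ε)
    (x : V → EuclideanSpace ℝ (Fin d)) (v : V) : hkPot G ε (hkStep G ε x v) ≤ hkPot G ε x := by
  have h := hkPot_drop G hε x v
  have h0 := hkDeg_nonneg G ε x v
  have : 0 ≤ (hkDeg G ε x v + 2) / (hkDeg G ε x v + 1) ^ 2 * ‖hkForce G ε x v‖ ^ 2 := by
    positivity
  linarith

theorem sq_sum_inner_hkForce_le [DecidableEq V] (G : SimpleGraph V) {ε : ℝ} (hε : 0 < ε)
    (x y : V → EuclideanSpace ℝ (Fin d)) (X : Finset V) (g : V → ℝ)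
    (hg : ∀ v, 0 ≤ g v)
    (h : ∀ v, 1 ≤ hkDeg G ε x v →
      (hkDeg G ε x v + 1) ^ 2 ≤ g v * (hkDeg G ε x v + 2)) :
    (∑ v ∈ X, inner ℝ (hkForce G ε x v) (y v)) ^ 2
      ≤ hkDrop G ε x * ∑ v ∈ X, g v * ‖y v‖ ^ 2 := by
  have hdrop : ∀ v, 0 ≤ hkPot G ε x - hkPot G ε (hkStep G ε x v) := fun v =>
    sub_nonneg.2 (hkPot_step_le G hε x v)
  have hX : ∑ v ∈ X, (hkPot G ε x - hkPot G ε (hkStep G ε x v)) ≤ hkDrop G ε x :=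
    Finset.sum_le_sum_of_subset_of_nonneg (Finset.subset_univ _) fun v _ _ => hdrop v
  have hgy : 0 ≤ ∑ v ∈ X, g v * ‖y v‖ ^ 2 :=
    Finset.sum_nonneg fun v _ => mul_nonneg (hg v) (sq_nonneg _)
  refine le_trans ?_ (mul_le_mul_of_nonneg_right hX hgy)
  refine Finset.sum_sq_le_sum_mul_sum_of_sq_le_mul X (fun v _ => hdrop v)
    (fun v _ => mul_nonneg (hg v) (sq_nonneg _)) fun v _ => ?_
  have h1 : (inner ℝ (hkForce G ε x v) (y v)) ^ 2 ≤ ‖hkForce G ε x v‖ ^ 2 * ‖y v‖ ^ 2 := by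
    rw [← mul_pow]
    exact sq_le_sq' (neg_le_of_abs_le (abs_real_inner_le_norm _ _)) (real_inner_le_norm _ _)
  refine h1.trans ?_
  rw [← mul_assoc]
  refine mul_le_mul_of_nonneg_right ?_ (sq_nonneg _)
  rcases hkForce_eq_zero_or G ε x v with h0 | h0
  · rw [h0]
    simpa using mul_nonneg (hdrop v) (hg v)
  · refine le_trans ?_ (mul_le_mul_of_nonneg_right (hkPot_drop G hε x v) (hg v))
    have h3 : 1 ≤ (hkDeg G ε x v + 2) / (hkDeg G ε x v + 1) ^ 2 * g v := by
      rw [div_mul_eq_mul_div, one_le_div (by positivity)]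
      linarith [h v h0]
    nlinarith [sq_nonneg ‖hkForce G ε x v‖]

theorem sum_inner_hkForce (G : SimpleGraph V) (ε : ℝ) (x y : V → EuclideanSpace ℝ (Fin d))
    (X : Finset V) (hX : ∀ u ∈ X, ∀ v, (hkInf G ε x).Adj u v → v ∈ X) :
    2 * ∑ u ∈ X, inner ℝ (hkForce G ε x u) (y u)
      = ∑ u ∈ X, ∑ v, if (hkInf G ε x).Adj u v then inner ℝ (x u - x v) (y u - y v) else 0 := by
  have hres : ∀ ψ : V → V → ℝ,
      ∑ u ∈ X, ∑ v, (if (hkInf G ε x).Adj u v then ψ u v else 0)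
        = ∑ u ∈ X, ∑ v ∈ X, if (hkInf G ε x).Adj u v then ψ u v else 0 := by
    intro ψ
    refine Finset.sum_congr rfl fun u hu => ?_
    refine (Finset.sum_subset (Finset.subset_univ X) fun v _ hv => ?_).symm
    exact if_neg fun hh => hv (hX u hu v hh)
  have h1 : ∑ u ∈ X, inner ℝ (hkForce G ε x u) (y u)
      = ∑ u ∈ X, ∑ v, if (hkInf G ε x).Adj u v then inner ℝ (x u - x v) (y u) else 0 := by
    refine Finset.sum_congr rfl fun u _ => ?_
    rw [hkForce, sum_inner]
    refine Finset.sum_congr rfl fun v _ => ?_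
    split_ifs <;> simp
  have h2 : ∑ u ∈ X, inner ℝ (hkForce G ε x u) (y u)
      = ∑ u ∈ X, ∑ v ∈ X, if (hkInf G ε x).Adj u v then inner ℝ (x v - x u) (y v) else 0 := by
    rw [h1, hres, Finset.sum_comm]
    simp_rw [(hkInf G ε x).adj_comm]
  rw [two_mul]
  nth_rewrite 1 [h1]
  rw [h2, hres, hres, ← Finset.sum_add_distrib]
  refine Finset.sum_congr rfl fun u _ => ?_
  rw [← Finset.sum_add_distrib]
  refine Finset.sum_congr rfl fun v _ => ?_
  split_ifs
  · rw [inner_sub_right, ← neg_sub (x u) (x v), inner_neg_left, ← sub_eq_add_neg]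
  · simp

theorem sum_adj_eq_two_mul_card (G : SimpleGraph V) :
    ∑ u, ∑ w, (if G.Adj u w then (1 : ℝ) else 0) = 2 * G.edgeFinset.card := by
  have h := G.sum_degrees_eq_twice_card_edges
  have h2 : ∀ u, ∑ w, (if G.Adj u w then (1 : ℝ) else 0) = G.degree u := by
    intro u
    rw [Finset.sum_boole, ← SimpleGraph.card_neighborFinset_eq_degree,
      SimpleGraph.neighborFinset_eq_filter]
  simp_rw [h2]
  exact_mod_cast h

theorem hkPot_le (G : SimpleGraph V) (ε : ℝ) (x : V → EuclideanSpace ℝ (Fin d)) :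
    hkPot G ε x ≤ G.edgeFinset.card * ε ^ 2 := by
  have h : ∑ u, ∑ w, (if G.Adj u w then min (‖x u - x w‖ ^ 2) (ε ^ 2) else 0)
      ≤ ∑ u, ∑ w, (if G.Adj u w then (1 : ℝ) else 0) * ε ^ 2 := by
    refine Finset.sum_le_sum fun u _ => Finset.sum_le_sum fun w _ => ?_
    split_ifs
    · rw [one_mul]; exact min_le_right _ _
    · simp
  simp_rw [← Finset.sum_mul, sum_adj_eq_two_mul_card] at h
  unfold hkPot
  linarith

theorem le_hkPot (G : SimpleGraph V) {ε : ℝ} (x : V → EuclideanSpace ℝ (Fin d)) {a b : V}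
    (hab : G.Adj a b) (hle : ‖x a - x b‖ ≤ ε) : ‖x a - x b‖ ^ 2 ≤ hkPot G ε x := by
  have hmin : min (‖x a - x b‖ ^ 2) (ε ^ 2) = ‖x a - x b‖ ^ 2 :=
    min_eq_left (pow_le_pow_left₀ (norm_nonneg _) hle 2)
  have h0 : ∀ u w, 0 ≤ if G.Adj u w then min (‖x u - x w‖ ^ 2) (ε ^ 2) else 0 := by
    intro u w
    split_ifs
    · positivity
    · rfl
  have h1 : ∀ u w, (if G.Adj u w then min (‖x u - x w‖ ^ 2) (ε ^ 2) else 0)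
      ≤ ∑ w, if G.Adj u w then min (‖x u - x w‖ ^ 2) (ε ^ 2) else 0 := fun u w =>
    Finset.single_le_sum (f := fun w => if G.Adj u w then min (‖x u - x w‖ ^ 2) (ε ^ 2) else 0)
      (fun w _ => h0 u w) (Finset.mem_univ w)
  have h2 := Finset.add_le_sum (f := fun u => ∑ w,
      if G.Adj u w then min (‖x u - x w‖ ^ 2) (ε ^ 2) else 0)
    (fun u _ => Finset.sum_nonneg fun w _ => h0 u w) (Finset.mem_univ a) (Finset.mem_univ b)
    hab.ne
  have ha := h1 a b
  have hb := h1 b a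
  rw [if_pos hab, hmin] at ha
  rw [if_pos hab.symm, norm_sub_rev, hmin] at hb
  unfold hkPot
  linarith

theorem exists_component_bounds [DecidableEq V] (G : SimpleGraph V) {ε δ : ℝ} (hε : 0 < ε)
    (hδ : 0 < δ) (x : V → EuclideanSpace ℝ (Fin d)) (hx : ¬ hkStable G ε δ x) :
    ∃ m : ℕ, 1 ≤ m ∧ m ≤ G.edgeFinset.card ∧ 12 * δ ^ 2 ≤ (7 * m + 1) * hkDrop G ε x ∧
      ∃ e : ℝ, 3 * Real.sin (Real.pi / (2 * m)) ^ 2 * e ≤ 2 * hkDrop G ε x ∧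
        hkPot G ε x ≤ e + (G.edgeFinset.card - m) * ε ^ 2 := by
  unfold hkStable at hx
  push Not at hx
  obtain ⟨a, b, hab, hle, hlt⟩ := hx
  set H := hkInf G ε x with hH
  have hHab : H.Adj a b := ⟨hab, hle⟩
  obtain ⟨X, m, z, haX, hclosed, hXcard, hz, hsum⟩ := H.exists_double_tour a
  have hbX : b ∈ X := hclosed a haX b hHab
  have hsm : ∑ u ∈ X, ∑ v, (if H.Adj u v then (1 : ℝ) else 0) = 2 * m := by
    rw [← hsum fun _ _ => 1]
    simp
  have hdegm : ∑ u ∈ X, hkDeg G ε x u = 2 * m := hsm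
  have hpair : ∀ ψ : V → V → ℝ, (∀ u v, 0 ≤ ψ u v) →
      ψ a b + ψ b a ≤ ∑ u ∈ X, ∑ v, if H.Adj u v then ψ u v else 0 := by
    intro ψ hψ
    have h0 : ∀ u v, 0 ≤ if H.Adj u v then ψ u v else 0 := fun u v => by
      split_ifs
      · exact hψ u v
      · rfl
    have h1 : ∀ u v, (if H.Adj u v then ψ u v else 0) ≤ ∑ v, if H.Adj u v then ψ u v else 0 :=
      fun u v => Finset.single_le_sum (f := fun v => if H.Adj u v then ψ u v else 0)
        (fun v _ => h0 u v) (Finset.mem_univ v)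
    have h2 := Finset.add_le_sum (f := fun u => ∑ v, if H.Adj u v then ψ u v else 0)
      (fun u _ => Finset.sum_nonneg fun v _ => h0 u v) haX hbX hab.ne
    have ha := h1 a b
    have hb := h1 b a
    rw [if_pos hHab] at ha
    rw [if_pos hHab.symm] at hb
    linarith
  have hm1 : 1 ≤ m := by
    have := hpair (fun _ _ => 1) fun _ _ => zero_le_one
    rw [hsm] at this
    have h : (1 : ℝ) ≤ m := by linarith
    exact_mod_cast h
  have hm0 : (1 : ℝ) ≤ m := by exact_mod_cast hm1
  have hXsub : ∀ ψ : V → V → ℝ, ∑ u ∈ X, ∑ v, (if H.Adj u v then ψ u v else 0)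
      = ∑ u, ∑ v, if u ∈ X ∧ H.Adj u v then ψ u v else 0 := by
    intro ψ
    rw [← Finset.sum_subset (Finset.subset_univ X)]
    · refine Finset.sum_congr rfl fun u hu => Finset.sum_congr rfl fun v _ => ?_
      simp [hu]
    · intro u _ hu
      simp [hu]
  refine ⟨m, hm1, ?_, ?_, ?_⟩
  · have h : 2 * (m : ℝ) ≤ 2 * G.edgeFinset.card := by
      rw [← hsm, ← sum_adj_eq_two_mul_card, hXsub]
      refine Finset.sum_le_sum fun u _ => Finset.sum_le_sum fun v _ => ?_
      by_cases h : u ∈ X ∧ H.Adj u v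
      · rw [if_pos h, if_pos h.2.1]
      · rw [if_neg h]; split_ifs <;> norm_num
    exact_mod_cast (mul_le_mul_iff_right₀ two_pos).1 h
  · set l := ‖x a - x b‖ with hl
    have hl0 : 0 < l := hδ.trans hlt
    set θ := l⁻¹ • (x a - x b) with hθ
    have hθ1 : ‖θ‖ = 1 := by
      rw [hθ, norm_smul, norm_inv, norm_norm, inv_mul_cancel₀ hl0.ne']
    set t : V → ℝ := fun v => inner ℝ (x v) θ with ht
    have htab : t a - t b = l := by
      simp only [ht]
      rw [← inner_sub_left, hθ, inner_smul_right, real_inner_self_eq_norm_sq, ← hl]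
      field_simp
    set s : V → ℝ := fun v => if t a ≤ t v then 1 else -1 with hs
    have hS := sum_inner_hkForce G ε x (fun v => s v • θ) X hclosed
    have hin : ∀ u v, inner ℝ (x u - x v) (s u • θ - s v • θ) = (s u - s v) * (t u - t v) := by
      intro u v
      rw [← sub_smul, inner_smul_right, inner_sub_left]
    simp_rw [hin] at hS
    have hp := hpair (fun u v => (s u - s v) * (t u - t v)) (by
      intro u v
      simp only [hs]
      split_ifs with h1 h2 h2
      · simp
      · nlinarith
      · nlinarith
      · simp)
    rw [← hS] at hp
    have hsa : s a = 1 := if_pos le_rfl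
    have hsb : s b = -1 := if_neg (by linarith)
    simp only [hsa, hsb] at hp
    have hC := sq_sum_inner_hkForce_le G hε x (fun v => s v • θ) X
      (fun v => hkDeg G ε x v + 1 / 3) (fun v => by linarith [hkDeg_nonneg G ε x v])
      (fun v hv => by nlinarith)
    have hn : ∀ v, ‖s v • θ‖ ^ 2 = 1 := by
      intro v
      rw [norm_smul, hθ1]
      simp only [hs]
      split_ifs <;> norm_num
    simp_rw [hn, mul_one] at hC
    rw [Finset.sum_add_distrib, hdegm, Finset.sum_const, nsmul_eq_mul] at hC
    have hXc : (X.card : ℝ) ≤ m + 1 := by exact_mod_cast hXcard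
    have hD0 : 0 ≤ hkDrop G ε x :=
      Finset.sum_nonneg fun v _ => sub_nonneg.2 (hkPot_step_le G hε x v)
    have h1 : (2 * δ) ^ 2 ≤ (∑ v ∈ X, inner ℝ (hkForce G ε x v) (s v • θ)) ^ 2 :=
      pow_le_pow_left₀ (by positivity) (by linarith) 2
    nlinarith [mul_le_mul_of_nonneg_left hXc hD0]
  · have hE : ∀ c, ∑ u ∈ X, inner ℝ (hkForce G ε x u) (x u - c) * 2
        = ∑ u ∈ X, ∑ v, if H.Adj u v then ‖x v - x u‖ ^ 2 else 0 := by
      intro c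
      rw [← Finset.sum_mul, mul_comm, sum_inner_hkForce G ε x (fun u => x u - c) X hclosed]
      refine Finset.sum_congr rfl fun u _ => Finset.sum_congr rfl fun v _ => ?_
      rw [sub_sub_sub_cancel_right, real_inner_self_eq_norm_sq, norm_sub_rev]
    set T := ∑ u ∈ X, ∑ v, (if H.Adj u v then ‖x v - x u‖ ^ 2 else 0) with hT
    have hT0 : 0 ≤ T := Finset.sum_nonneg fun u _ => Finset.sum_nonneg fun v _ => by
      split_ifs
      · positivity
      · rfl
    refine ⟨T / 2, ?_, ?_⟩
    · obtain ⟨c, hc⟩ := wirtinger_closed (N := 2 * m) (by omega) (fun i => x (z i))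
        (by simp only [hz])
      rw [hsum fun u v => ‖x v - x u‖ ^ 2, hsum fun u _ => ‖x u - c‖ ^ 2, ← hT] at hc
      have hC := sq_sum_inner_hkForce_le G hε x (fun v => x v - c) X
        (fun v => 4 / 3 * hkDeg G ε x v)
        (fun v => by linarith [hkDeg_nonneg G ε x v]) (fun v hv => by nlinarith)
      have h1 : ∑ v ∈ X, inner ℝ (hkForce G ε x v) (x v - c) = T / 2 := by
        rw [← hE c, ← Finset.sum_mul]; ring
      have h2 : ∑ v ∈ X, 4 / 3 * hkDeg G ε x v * ‖x v - c‖ ^ 2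
          = 4 / 3 * ∑ u ∈ X, ∑ v, if H.Adj u v then ‖x u - c‖ ^ 2 else 0 := by
        rw [Finset.mul_sum]
        refine Finset.sum_congr rfl fun u _ => ?_
        rw [hkDeg, mul_assoc, Finset.sum_mul]
        simp only [ite_mul, one_mul, zero_mul]
        rfl
      rw [h1, h2] at hC
      set P := ∑ u ∈ X, ∑ v, (if H.Adj u v then ‖x u - c‖ ^ 2 else 0)
      have hD0 : 0 ≤ hkDrop G ε x :=
        Finset.sum_nonneg fun v _ => sub_nonneg.2 (hkPot_step_le G hε x v)
      push_cast at hc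
      set S := Real.sin (Real.pi / (2 * m)) ^ 2
      rcases hT0.eq_or_lt with h0 | h0
      · rw [← h0]; linarith
      · refine le_of_mul_le_mul_right ?_ h0
        have hS0 : 0 ≤ S := sq_nonneg _
        nlinarith [mul_le_mul_of_nonneg_left hc hD0, mul_le_mul_of_nonneg_left hC hS0]
    · have h : ∑ u, ∑ w, (if G.Adj u w then min (‖x u - x w‖ ^ 2) (ε ^ 2) else 0)
          ≤ T + (2 * G.edgeFinset.card - 2 * m) * ε ^ 2 := by
        rw [← hsm, ← sum_adj_eq_two_mul_card, hT, hXsub, hXsub, ← Finset.sum_sub_distrib,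
          Finset.sum_mul, ← Finset.sum_add_distrib]
        refine Finset.sum_le_sum fun u _ => ?_
        rw [← Finset.sum_sub_distrib, Finset.sum_mul, ← Finset.sum_add_distrib]
        refine Finset.sum_le_sum fun v _ => ?_
        by_cases h : u ∈ X ∧ H.Adj u v
        · rw [if_pos h, if_pos h, if_pos h.2.1, if_pos h.2.1, norm_sub_rev]
          simp
        · rw [if_neg h, if_neg h]
          split_ifs
          · simp
          · simp
      unfold hkPot
      linarith

end Potential

/-- The function equal to the identity up to `1` and continued by `1 + log` afterwards. -/
noncomputable def linLog (r : ℝ) : ℝ := if r ≤ 1 then r else 1 + Real.log r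

theorem mul_le_linLog_sub {a b c : ℝ} (hba : b ≤ a) (hc1 : c ≤ 1) (hca : c * a ≤ 1) :
    c * (a - b) ≤ linLog a - linLog b := by
  unfold linLog
  by_cases ha1 : a ≤ 1
  · rw [if_pos ha1, if_pos (hba.trans ha1)]
    nlinarith
  · push Not at ha1
    have ha0 : 0 < a := by linarith
    have hc : c ≤ a⁻¹ := by rwa [← one_div, le_div_iff₀ ha0]
    have hlhs : c * (a - b) ≤ 1 - b / a := by
      have := mul_le_mul_of_nonneg_right hc (sub_nonneg.2 hba)
      refine this.trans (le_of_eq ?_)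
      field_simp
    refine hlhs.trans ?_
    rw [if_neg (not_le.2 ha1)]
    split_ifs with hb1
    · have h := Real.one_sub_inv_le_log_of_pos ha0
      have hinv : a⁻¹ ≤ 1 := inv_le_one_of_one_le₀ ha1.le
      rw [div_eq_mul_inv]
      nlinarith
    · push Not at hb1
      have hb0 : 0 < b := by linarith
      have h := Real.one_sub_inv_le_log_of_pos (div_pos ha0 hb0)
      rw [Real.log_div ha0.ne' hb0.ne', inv_div] at h
      linarith

theorem linLog_mono {a b : ℝ} (hba : b ≤ a) : linLog b ≤ linLog a := by
  have := mul_le_linLog_sub (c := 0) hba zero_le_one (by simp)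
  linarith

theorem linLog_le {r : ℝ} (hr : 0 ≤ r) : linLog r ≤ 3 / 4 + 0.48 * r := by
  have hexp : (0.48 : ℝ) * Real.exp (3 / 4) ≥ 1 := by
    have := Real.sum_le_exp_of_nonneg (x := 3 / 4) (by norm_num) 4
    norm_num [Finset.sum_range_succ, Nat.factorial] at this
    linarith
  unfold linLog
  split_ifs with h
  · linarith
  · push Not at h
    have hr0 : 0 < r := by linarith
    have h1 := Real.log_le_sub_one_of_pos (div_pos hr0 (Real.exp_pos (3 / 4)))
    rw [Real.log_div hr0.ne' (Real.exp_pos _).ne', Real.log_exp] at h1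
    have h2 : r / Real.exp (3 / 4) ≤ 0.48 * r := by
      rw [div_le_iff₀ (Real.exp_pos _)]
      nlinarith
    linarith

theorem two_le_sin_sq_mul {m : ℕ} (hm : 1 ≤ m) :
    2 ≤ 3 * Real.sin (Real.pi / (2 * m)) ^ 2 * (0.28 * m ^ 2 + 0.41) := by
  rcases hm.eq_or_lt with rfl | hm
  · norm_num
  · have hm2 : (2 : ℝ) ≤ m := by exact_mod_cast hm
    have hm0 : (0 : ℝ) < m := by linarith
    have hpi1 := Real.pi_gt_d2
    have hpi2 := Real.pi_lt_d2
    set x := Real.pi / (2 * m) with hx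
    have hx0 : 0 < x := by positivity
    have hxm : x * (2 * m) = Real.pi := by rw [hx]; field_simp
    have hx1 : x ≤ 0.7875 := by
      rw [hx, div_le_iff₀ (by positivity)]
      nlinarith
    have hs := Real.sin_gt_sub_cube hx0
    have hs0 : 0 ≤ x * (1 - x ^ 2 / 6) := by
      apply mul_nonneg hx0.le
      nlinarith
    have hsq : (x * (1 - x ^ 2 / 6)) ^ 2 ≤ Real.sin x ^ 2 :=
      pow_le_pow_left₀ hs0 (by nlinarith) 2
    have hu : x ^ 2 ≤ 0.6202 := by nlinarith
    have hpisq : 9.8596 ≤ 4 * (x * m) ^ 2 := by nlinarith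
    have key : 2 ≤ 3 * (x * (1 - x ^ 2 / 6)) ^ 2 * (0.28 * m ^ 2 + 0.41) := by
      have : 3 * (x * (1 - x ^ 2 / 6)) ^ 2 * (0.28 * m ^ 2 + 0.41)
          = 3 * (1 - x ^ 2 / 6) ^ 2 * (0.28 * (x * m) ^ 2 + 0.41 * x ^ 2) := by ring
      rw [this]
      set u := x ^ 2
      have hu0 : 0 ≤ u := sq_nonneg x
      have h1 : 0.69017 + 0.41 * u ≤ 0.28 * (x * m) ^ 2 + 0.41 * u := by linarith
      have h2 : 2 ≤ 3 * (1 - u / 6) ^ 2 * (0.69017 + 0.41 * u) := by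
        nlinarith [mul_nonneg hu0 (sub_nonneg.2 hu), mul_nonneg hu0 hu0,
          mul_nonneg (mul_nonneg hu0 hu0) (sub_nonneg.2 hu)]
      exact h2.trans (mul_le_mul_of_nonneg_left h1 (by positivity))
    exact key.trans (mul_le_mul_of_nonneg_right
      (mul_le_mul_of_nonneg_left hsq (by norm_num)) (by positivity))

theorem exists_potential_constants {E : ℕ} (hE : 2 ≤ E) {ρ : ℝ} (hρ : 1 ≤ ρ) :
    ∃ A Q : ℝ, 0 < A ∧ A ≤ Q ∧
      (∀ m : ℕ, 1 ≤ m → m ≤ E → (7 * m + 1 : ℝ) ≤ 12 * A ∧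
        ∃ K, 2 ≤ 3 * Real.sin (Real.pi / (2 * m)) ^ 2 * K ∧
          K + ρ * ((7 * m + 1) * (E - m) / 12) ≤ Q) ∧
      3 / 4 * Q + 0.48 * (A * (E * ρ)) - A + 1 ≤ E ^ 2 * ρ / 2 := by
  rcases hE.eq_or_lt with rfl | hE
  · refine ⟨5 / 4, 2 / 3 * (1 + ρ), by norm_num, by linarith, ?_, ?_⟩
    · intro m h1 h2
      interval_cases m
      · refine ⟨by norm_num, 2 / 3, ?_, ?_⟩
        · norm_num
        · norm_num; linarith
      · refine ⟨by norm_num, 4 / 3, ?_, ?_⟩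
        · have : Real.pi / (2 * (2 : ℕ)) = Real.pi / 4 := by norm_num
          rw [this, Real.sin_pi_div_four, div_pow, Real.sq_sqrt (by norm_num)]
          norm_num
        · norm_num; linarith
    · norm_num; linarith
  · have hE3 : (3 : ℝ) ≤ E := by exact_mod_cast hE
    set e := (E : ℝ)
    have hB : 0 ≤ (7 * e + 1) ^ 2 / 336 := by positivity
    refine ⟨(7 * e + 1) / 12, 0.281 * e ^ 2 + 0.01 * e + 0.41 + (ρ - 1) * ((7 * e + 1) ^ 2 / 336),
      by positivity, ?_, ?_, ?_⟩
    · nlinarith [mul_nonneg (sub_nonneg.2 hρ) hB]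
    · intro m h1 h2
      have hm1 : (1 : ℝ) ≤ m := by exact_mod_cast h1
      have hm2 : (m : ℝ) ≤ e := Nat.cast_le.2 h2
      refine ⟨by linarith, 0.28 * m ^ 2 + 0.41, two_le_sin_sq_mul h1, ?_⟩
      have hb : (7 * m + 1) * (e - m) / 12 ≤ (7 * e + 1) ^ 2 / 336 := by
        nlinarith [sq_nonneg (14 * (m : ℝ) + 1 - 7 * e)]
      have hq : 0.28 * (m : ℝ) ^ 2 + 0.41 + (7 * m + 1) * (e - m) / 12
          ≤ 0.281 * e ^ 2 + 0.01 * e + 0.41 := by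
        nlinarith [sq_nonneg ((m : ℝ) - 0.9615 * e + 0.137)]
      nlinarith [mul_le_mul_of_nonneg_left hb (sub_nonneg.2 hρ)]
    · have hslope : 0 ≤ e ^ 2 / 2 - 0.48 * ((7 * e + 1) / 12 * e)
          - 3 / 4 * ((7 * e + 1) ^ 2 / 336) := by nlinarith
      nlinarith [mul_nonneg (sub_nonneg.2 hρ) hslope]

section Lyapunov

variable {d : ℕ} {V : Type*} [Fintype V]

theorem hkPot_gt_of_not_hkStable (G : SimpleGraph V) {ε δ : ℝ} (hδ : 0 < δ)
    {x : V → EuclideanSpace ℝ (Fin d)} (hx : ¬ hkStable G ε δ x) : δ ^ 2 < hkPot G ε x := by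
  unfold hkStable at hx
  push Not at hx
  obtain ⟨a, b, hab, hle, hlt⟩ := hx
  exact (pow_lt_pow_left₀ hlt hδ.le two_ne_zero).trans_le (le_hkPot G x hab hle)

theorem hkPot_nonneg (G : SimpleGraph V) (ε : ℝ) (x : V → EuclideanSpace ℝ (Fin d)) :
    0 ≤ hkPot G ε x := by
  refine div_nonneg (Finset.sum_nonneg fun u _ => Finset.sum_nonneg fun w _ => ?_) two_pos.le
  split_ifs
  · positivity
  · rfl

variable [DecidableEq V]

/-- A function on states that decreases in expectation by at least `1 / n` from every unstable
state and is bounded by the claimed number of rounds. -/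
structure IsHkLyapunov (G : SimpleGraph V) (ε δ B : ℝ)
    (L : (V → EuclideanSpace ℝ (Fin d)) → ℝ) : Prop where
  nonneg : ∀ x, 0 ≤ L x
  drift : ∀ x, ¬ hkStable G ε δ x → ∑ v, L (hkStep G ε x v) ≤ Fintype.card V * L x - 1
  le : ∀ x, L x ≤ B

theorem sum_hkPot_step (G : SimpleGraph V) (ε : ℝ) (x : V → EuclideanSpace ℝ (Fin d)) :
    ∑ v, hkPot G ε (hkStep G ε x v) = Fintype.card V * hkPot G ε x - hkDrop G ε x := by
  simp [hkDrop, Finset.sum_sub_distrib]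

theorem exists_lyapunov_of_two_le (G : SimpleGraph V) {ε δ : ℝ} (hε : 0 < ε) (hδ : 0 < δ)
    (hδε : δ < ε) (hE : 2 ≤ G.edgeFinset.card) :
    ∃ L : (V → EuclideanSpace ℝ (Fin d)) → ℝ,
      IsHkLyapunov G ε δ ((G.edgeFinset.card : ℝ) ^ 2 * ε ^ 2 / (2 * δ ^ 2)) L := by
  have hδ2 : 0 < δ ^ 2 := by positivity
  have hρ : 1 ≤ ε ^ 2 / δ ^ 2 := by
    rw [one_le_div hδ2]
    exact pow_le_pow_left₀ hδ.le hδε.le 2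
  obtain ⟨A, Q, hA, hAQ, hm, hfin⟩ := exists_potential_constants hE hρ
  have hQ : 0 < Q := hA.trans_le hAQ
  set c := A / (Q * δ ^ 2) with hc
  have hc0 : 0 < c := by positivity
  set F : (V → EuclideanSpace ℝ (Fin d)) → ℝ := fun x => Q * linLog (c * hkPot G ε x) - A + 1
    with hF
  have hF1 : ∀ x, ¬ hkStable G ε δ x → 1 ≤ F x := by
    intro x hx
    have h1 := hkPot_gt_of_not_hkStable G hδ hx
    have h2 : A / Q ≤ c * hkPot G ε x := by
      have : c * δ ^ 2 = A / Q := by rw [hc]; field_simp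
      rw [← this]
      exact mul_le_mul_of_nonneg_left h1.le hc0.le
    have h3 := linLog_mono h2
    rw [linLog, if_pos ((div_le_one hQ).2 hAQ), div_le_iff₀ hQ] at h3
    simp only [hF]
    linarith
  have hFmono : ∀ x v, F (hkStep G ε x v) ≤ F x := by
    intro x v
    have := linLog_mono (mul_le_mul_of_nonneg_left (hkPot_step_le G hε x v) hc0.le)
    simp only [hF]
    nlinarith
  set L : (V → EuclideanSpace ℝ (Fin d)) → ℝ := fun x => if hkStable G ε δ x then 0 else F x
    with hL
  refine ⟨L, ?_, ?_, ?_⟩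
  · intro x
    simp only [hL]
    split_ifs with h
    · exact le_rfl
    · linarith [hF1 x h]
  · intro x hx
    have hLx : L x = F x := if_neg hx
    have hFx := hF1 x hx
    have hstep : ∀ v, L (hkStep G ε x v) ≤ F x := by
      intro v
      simp only [hL]
      split_ifs
      · linarith
      · exact hFmono x v
    rw [hLx]
    by_cases hs : ∃ v, hkStable G ε δ (hkStep G ε x v)
    · obtain ⟨v, hv⟩ := hs
      have h0 : L (hkStep G ε x v) = 0 := if_pos hv
      have hle : ∑ u, L (hkStep G ε x u) ≤ ∑ u, (F x - if u = v then F x else 0) := by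
        refine Finset.sum_le_sum fun u _ => ?_
        split_ifs with huv
        · rw [huv, h0, sub_self]
        · rw [sub_zero]; exact hstep u
      simp only [Finset.sum_sub_distrib, Finset.sum_const, Finset.card_univ, nsmul_eq_mul,
        Finset.sum_ite_eq', Finset.mem_univ, if_true] at hle
      linarith
    · push Not at hs
      have hLs : ∀ v, L (hkStep G ε x v) = F (hkStep G ε x v) := fun v => if_neg (hs v)
      simp_rw [hLs]
      obtain ⟨m, hm1, hmE, hi, e, he, hΦ⟩ := exists_component_bounds G hε hδ x hx
      obtain ⟨hmA, K, hK, hKQ⟩ := hm m hm1 hmE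
      have hD0 : 0 ≤ hkDrop G ε x :=
        Finset.sum_nonneg fun v _ => sub_nonneg.2 (hkPot_step_le G hε x v)
      have hΦ0 : 0 < hkPot G ε x := hδ2.trans (hkPot_gt_of_not_hkStable G hδ hx)
      have hI : δ ^ 2 ≤ A * hkDrop G ε x := by nlinarith
      have hII : hkPot G ε x ≤ Q * hkDrop G ε x := by
        set S := Real.sin (Real.pi / (2 * m)) ^ 2
        have hS : 0 < S := by
          rcases (sq_nonneg (Real.sin (Real.pi / (2 * m)))).eq_or_lt with h | h
          · rw [show S = 0 from h.symm] at hK; norm_num at hK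
          · exact h
        have heK : e ≤ K * hkDrop G ε x := by
          refine le_of_mul_le_mul_left ?_ (mul_pos three_pos hS)
          nlinarith
        have hEm : 0 ≤ (G.edgeFinset.card : ℝ) - m :=
          sub_nonneg.2 (by exact_mod_cast hmE)
        have hr : (G.edgeFinset.card - m : ℝ) * ε ^ 2
            ≤ ε ^ 2 / δ ^ 2 * ((7 * m + 1) * (G.edgeFinset.card - m) / 12) * hkDrop G ε x := by
          have : ε ^ 2 = ε ^ 2 / δ ^ 2 * δ ^ 2 := by field_simp
          have h2 := mul_le_mul_of_nonneg_left hi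
            (mul_nonneg hEm (show 0 ≤ ε ^ 2 / δ ^ 2 by positivity))
          nlinarith
        nlinarith
      set k := min 1 (c * hkPot G ε x)⁻¹ with hk
      have hcΦ : 0 < c * hkPot G ε x := mul_pos hc0 hΦ0
      have hk1 : k ≤ 1 := min_le_left _ _
      have hk2 : k * (c * hkPot G ε x) ≤ 1 := by
        rw [← le_div_iff₀ hcΦ, one_div]
        exact min_le_right _ _
      have hkD : 1 ≤ Q * (k * (c * hkDrop G ε x)) := by
        rcases min_choice 1 (c * hkPot G ε x)⁻¹ with h | h
        · rw [hk, h, hc]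
          have : Q * (1 * (A / (Q * δ ^ 2) * hkDrop G ε x)) = A * hkDrop G ε x / δ ^ 2 := by
            field_simp
          rw [this, one_le_div hδ2]
          exact hI
        · rw [hk, h]
          have : Q * ((c * hkPot G ε x)⁻¹ * (c * hkDrop G ε x))
              = Q * hkDrop G ε x / hkPot G ε x := by
            field_simp
          rw [this, one_le_div hΦ0]
          exact hII
      have hsum : ∑ v, Q * (k * (c * (hkPot G ε x - hkPot G ε (hkStep G ε x v))))
          ≤ ∑ v, (F x - F (hkStep G ε x v)) := by
        refine Finset.sum_le_sum fun v _ => ?_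
        have := mul_le_linLog_sub
          (mul_le_mul_of_nonneg_left (hkPot_step_le G hε x v) hc0.le) hk1 hk2
        simp only [hF]
        rw [← mul_sub] at this
        nlinarith
      rw [← Finset.mul_sum, ← Finset.mul_sum, ← Finset.mul_sum] at hsum
      change Q * (k * (c * hkDrop G ε x)) ≤ _ at hsum
      simp only [Finset.sum_sub_distrib, Finset.sum_const, Finset.card_univ, nsmul_eq_mul] at hsum
      linarith
  · intro x
    simp only [hL]
    split_ifs
    · positivity
    · have h1 := linLog_le (mul_nonneg hc0.le (hkPot_nonneg G ε x))
      have h2 : Q * (c * hkPot G ε x) ≤ A * (G.edgeFinset.card * (ε ^ 2 / δ ^ 2)) := by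
        have : Q * (c * hkPot G ε x) = A * (hkPot G ε x / δ ^ 2) := by
          rw [hc]; field_simp
        rw [this, ← mul_div_assoc (G.edgeFinset.card : ℝ)]
        exact mul_le_mul_of_nonneg_left (div_le_div_of_nonneg_right (hkPot_le G ε x) hδ2.le) hA.le
      have h3 := mul_le_mul_of_nonneg_left h1 hQ.le
      have h4 : (G.edgeFinset.card : ℝ) ^ 2 * ε ^ 2 / (2 * δ ^ 2)
          = G.edgeFinset.card ^ 2 * (ε ^ 2 / δ ^ 2) / 2 := by field_simp
      rw [h4]
      simp only [hF]
      nlinarith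

theorem exists_lyapunov_of_eq_one (G : SimpleGraph V) {ε δ : ℝ} (hε : 0 < ε) (hδ : 0 < δ)
    (hE : G.edgeFinset.card = 1) :
    ∃ L : (V → EuclideanSpace ℝ (Fin d)) → ℝ,
      IsHkLyapunov G ε δ ((G.edgeFinset.card : ℝ) ^ 2 * ε ^ 2 / (2 * δ ^ 2)) L := by
  have hδ2 : 0 < δ ^ 2 := by positivity
  have huniq : ∀ a b u w, G.Adj a b → G.Adj u w → (u = a ∧ w = b) ∨ (u = b ∧ w = a) := by
    intro a b u w hab huw
    obtain ⟨e, he⟩ := Finset.card_eq_one.1 hE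
    have h1 : s(a, b) ∈ G.edgeFinset := by simpa using hab
    have h2 : s(u, w) ∈ G.edgeFinset := by simpa using huw
    rw [he, Finset.mem_singleton] at h1 h2
    simpa using h2.trans h1.symm
  have hhalf : ∀ (x : V → EuclideanSpace ℝ (Fin d)) a b, G.Adj a b → ‖x a - x b‖ ≤ ε →
      ∀ u w, G.Adj u w → ‖hkStep G ε x a u - hkStep G ε x a w‖ = ‖x a - x b‖ / 2 := by
    intro x a b hab hle
    have hadj : ∀ u, (hkInf G ε x).Adj a u ↔ u = b := by
      intro u
      constructor
      · intro h
        rcases huniq a b a u hab h.1 with h | h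
        · exact h.2
        · exact absurd h.1 hab.ne
      · rintro rfl
        exact ⟨hab, hle⟩
    have hdeg : hkDeg G ε x a = 1 := by simp [hkDeg, hadj]
    have hforce : hkForce G ε x a = x a - x b := by simp [hkForce, hadj]
    have hmain : ‖hkStep G ε x a a - hkStep G ε x a b‖ = ‖x a - x b‖ / 2 := by
      rw [hkStep_eq, hdeg, hforce, Function.update_self, Function.update_of_ne hab.ne']
      have : x a - ((1 : ℝ) + 1)⁻¹ • (x a - x b) - x b = (2 : ℝ)⁻¹ • (x a - x b) := by
        module
      rw [this, norm_smul]
      norm_num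
      ring
    intro u w huw
    rcases huniq a b u w hab huw with ⟨rfl, rfl⟩ | ⟨rfl, rfl⟩
    · exact hmain
    · rw [norm_sub_rev, hmain]
  set L : (V → EuclideanSpace ℝ (Fin d)) → ℝ :=
    fun x => if hkStable G ε δ x then 0 else hkPot G ε x / (2 * δ ^ 2) with hL
  have hLle : ∀ x, L x ≤ hkPot G ε x / (2 * δ ^ 2) := by
    intro x
    simp only [hL]
    split_ifs
    · exact div_nonneg (hkPot_nonneg G ε x) (by positivity)
    · exact le_rfl
  refine ⟨L, ?_, ?_, ?_⟩
  · intro x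
    simp only [hL]
    split_ifs
    · exact le_rfl
    · exact div_nonneg (hkPot_nonneg G ε x) (by positivity)
  · intro x hx
    have hLx : L x = hkPot G ε x / (2 * δ ^ 2) := if_neg hx
    have hpot := hkPot_gt_of_not_hkStable G hδ hx
    obtain ⟨m, hm1, hmE, -, e, he, hΦ⟩ := exists_component_bounds G hε hδ x hx
    obtain rfl : m = 1 := by omega
    have hx' := hx
    unfold hkStable at hx'
    push Not at hx'
    obtain ⟨a, b, hab, hle, hlt⟩ := hx'
    rcases le_or_gt (‖x a - x b‖ / 2) δ with hhd | hhd
    · have hsa : L (hkStep G ε x a) = 0 := by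
        refine if_pos fun u w huw _ => ?_
        rw [hhalf x a b hab hle u w huw]
        exact hhd
      have hsb : L (hkStep G ε x b) = 0 := by
        refine if_pos fun u w huw _ => ?_
        rw [hhalf x b a hab.symm (by rwa [norm_sub_rev]) u w huw, norm_sub_rev]
        exact hhd
      have hle2 : ∑ u, L (hkStep G ε x u)
          ≤ ∑ u, (L x - (if u = a then L x else 0) - if u = b then L x else 0) := by
        refine Finset.sum_le_sum fun u _ => ?_
        by_cases hua : u = a
        · subst hua
          rw [hsa, if_pos rfl, if_neg hab.ne]
          simp
        · by_cases hub : u = b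
          · subst hub
            rw [hsb, if_pos rfl, if_neg hua]
            simp
          · rw [if_neg hua, if_neg hub, sub_zero, sub_zero, hLx]
            exact (hLle _).trans
              (div_le_div_of_nonneg_right (hkPot_step_le G hε x u) (by positivity))
      simp only [Finset.sum_sub_distrib, Finset.sum_const, Finset.card_univ, nsmul_eq_mul,
        Finset.sum_ite_eq', Finset.mem_univ, if_true] at hle2
      have : 1 / 2 ≤ L x := by
        rw [hLx, div_le_div_iff₀ two_pos (by positivity)]
        linarith
      linarith
    · have hpot2 := le_hkPot G x hab hle
      have hfour : (2 * δ) ^ 2 ≤ ‖x a - x b‖ ^ 2 :=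
        pow_le_pow_left₀ (by positivity) (by linarith) 2
      rw [hE] at hΦ
      norm_num at he hΦ
      have hsum : ∑ v, L (hkStep G ε x v) ≤ ∑ v, hkPot G ε (hkStep G ε x v) / (2 * δ ^ 2) :=
        Finset.sum_le_sum fun v _ => hLle _
      rw [← Finset.sum_div, sum_hkPot_step, sub_div, mul_div_assoc, ← hLx] at hsum
      have : 1 ≤ hkDrop G ε x / (2 * δ ^ 2) := by
        rw [one_le_div (by positivity)]
        nlinarith
      linarith
  · intro x
    refine (hLle x).trans ?_
    have := hkPot_le G ε x
    rw [hE] at this ⊢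
    gcongr
    simpa using this

theorem exists_lyapunov (G : SimpleGraph V) {ε δ : ℝ} (hε : 0 < ε) (hδ : 0 < δ) (hδε : δ < ε) :
    ∃ L : (V → EuclideanSpace ℝ (Fin d)) → ℝ,
      IsHkLyapunov G ε δ ((G.edgeFinset.card : ℝ) ^ 2 * ε ^ 2 / (2 * δ ^ 2)) L := by
  rcases Nat.lt_or_ge G.edgeFinset.card 2 with h | h
  · interval_cases hE : G.edgeFinset.card
    · refine ⟨fun _ => 0, fun _ => le_rfl, fun x hx => ?_, fun _ => by positivity⟩
      obtain ⟨m, hm1, hmE, -⟩ := exists_component_bounds G hε hδ x hx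
      omega
    · have := exists_lyapunov_of_eq_one (d := d) G hε hδ hE
      rwa [hE] at this
  · exact exists_lyapunov_of_two_le G hε hδ hδε h

end Lyapunov

section Restriction

variable {V : Type*} [Fintype V] [MeasurableSpace V] [MeasurableSingletonClass V]

theorem measurable_comp_restrict {t : ℕ} (g : (Fin t → V) → ℝ≥0∞) :
    Measurable fun σ : ℕ → V => g fun i => σ i :=
  (measurable_of_finite g).comp (measurable_pi_lambda _ fun _ => measurable_pi_apply _)

variable [Nonempty V] in
theorem lintegral_comp_restrict (μ : Measure (ℕ → V))
    (hiid : ∀ (s : Finset ℕ) (f : ℕ → V),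
      μ {σ | ∀ i ∈ s, σ i = f i} = ((Fintype.card V : ℝ≥0∞))⁻¹ ^ s.card)
    {t : ℕ} (g : (Fin t → V) → ℝ≥0∞) :
    ∫⁻ σ, g (fun i => σ i) ∂μ = (∑ w, g w) * ((Fintype.card V : ℝ≥0∞))⁻¹ ^ t := by
  have hr : Measurable fun (σ : ℕ → V) (i : Fin t) => σ i :=
    measurable_pi_lambda _ fun i => measurable_pi_apply _
  rw [← lintegral_map (measurable_of_finite g) hr, lintegral_fintype, Finset.sum_mul]
  refine Finset.sum_congr rfl fun w _ => ?_
  rw [Measure.map_apply hr (measurableSet_singleton w)]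
  have := hiid (Finset.range t) fun i =>
    if h : i < t then w ⟨i, h⟩ else Classical.arbitrary V
  rw [Finset.card_range] at this
  rw [← this]
  congr 2
  ext σ
  simp only [Set.mem_preimage, Set.mem_singleton_iff, funext_iff, Finset.mem_range,
    Set.mem_ofPred_eq]
  constructor
  · intro h i hi
    rw [dif_pos hi, ← h ⟨i, hi⟩]
  · intro h i
    rw [h i i.2, dif_pos i.2]

end Restriction

section HittingTime

variable {d : ℕ} {V : Type*} [Fintype V] [DecidableEq V]

theorem hkTraj_succ' (G : SimpleGraph V) (ε : ℝ) (x : V → EuclideanSpace ℝ (Fin d)) (σ : ℕ → V)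
    (s : ℕ) : hkTraj G ε x σ (s + 1) = hkTraj G ε (hkStep G ε x (σ 0)) (fun i => σ (i + 1)) s := by
  induction s with
  | zero => rfl
  | succ s ih => rw [hkTraj, ih, hkTraj]

/-- The number of steps, capped at `t`, taken before a stable state is reached. -/
noncomputable def hkCount (G : SimpleGraph V) (ε δ : ℝ) :
    (t : ℕ) → (V → EuclideanSpace ℝ (Fin d)) → (Fin t → V) → ℕ
  | 0, _, _ => 0
  | t + 1, x, w =>
    if hkStable G ε δ x then 0 else 1 + hkCount G ε δ t (hkStep G ε x (w 0)) (Fin.tail w)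

theorem le_hkCount (G : SimpleGraph V) (ε δ : ℝ) {k t : ℕ} (hkt : k ≤ t)
    (x : V → EuclideanSpace ℝ (Fin d)) (σ : ℕ → V)
    (h : ∀ s < k, ¬ hkStable G ε δ (hkTraj G ε x σ s)) :
    k ≤ hkCount G ε δ t x fun i => σ i := by
  induction t generalizing k x σ with
  | zero => omega
  | succ t ih =>
    rcases k with _ | k
    · exact Nat.zero_le _
    · have h0 : ¬ hkStable G ε δ x := h 0 (by omega)
      have := ih (k := k) (by omega) (hkStep G ε x (σ 0)) (fun i => σ (i + 1)) fun s hs => by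
        rw [← hkTraj_succ']
        exact h (s + 1) (by omega)
      rw [hkCount, if_neg h0, add_comm]
      exact Nat.add_le_add_left this 1

theorem sum_hkCount_le {G : SimpleGraph V} {ε δ B : ℝ} {L : (V → EuclideanSpace ℝ (Fin d)) → ℝ}
    (hL : IsHkLyapunov G ε δ B L) (t : ℕ) (x : V → EuclideanSpace ℝ (Fin d)) :
    ∑ w : Fin t → V, (hkCount G ε δ t x w : ℝ)
      ≤ (Fintype.card V : ℝ) ^ t * (Fintype.card V * L x) := by
  induction t generalizing x with
  | zero =>
    have := hL.nonneg x
    simp only [hkCount, Nat.cast_zero, Finset.sum_const_zero]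
    positivity
  | succ t ih =>
    by_cases hx : hkStable G ε δ x
    · have := hL.nonneg x
      simp only [hkCount, if_pos hx, Nat.cast_zero, Finset.sum_const_zero]
      positivity
    · have h1 : ∑ w : Fin (t + 1) → V, (hkCount G ε δ (t + 1) x w : ℝ)
          = ∑ v, ∑ w : Fin t → V, (1 + (hkCount G ε δ t (hkStep G ε x v) w : ℝ)) := by
        rw [← Fintype.sum_prod_type', ← (Fin.consEquiv fun _ : Fin (t + 1) => V).sum_comp]
        refine Finset.sum_congr rfl fun p _ => ?_
        simp [hkCount, if_neg hx, Fin.consEquiv]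
      have h2 : ∀ v, ∑ w : Fin t → V, (1 + (hkCount G ε δ t (hkStep G ε x v) w : ℝ))
          ≤ (Fintype.card V : ℝ) ^ t * (1 + Fintype.card V * L (hkStep G ε x v)) := by
        intro v
        rw [Finset.sum_add_distrib, mul_add]
        refine add_le_add (le_of_eq ?_) (ih _)
        simp
      rw [h1]
      refine (Finset.sum_le_sum fun v _ => h2 v).trans ?_
      rw [← Finset.mul_sum, Finset.sum_add_distrib, ← Finset.mul_sum, pow_succ, mul_assoc]
      refine mul_le_mul_of_nonneg_left ?_ (by positivity)
      have h3 := mul_le_mul_of_nonneg_left (hL.drift x hx)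
        (Nat.cast_nonneg (α := ℝ) (Fintype.card V))
      simp only [Finset.sum_const, Finset.card_univ, nsmul_eq_mul, mul_one]
      linarith

variable [Nonempty V] [MeasurableSpace V] [MeasurableSingletonClass V]

theorem lintegral_hkCount_le {G : SimpleGraph V} {ε δ B : ℝ}
    {L : (V → EuclideanSpace ℝ (Fin d)) → ℝ} (hL : IsHkLyapunov G ε δ B L)
    (μ : Measure (ℕ → V))
    (hiid : ∀ (s : Finset ℕ) (f : ℕ → V),
      μ {σ | ∀ i ∈ s, σ i = f i} = ((Fintype.card V : ℝ≥0∞))⁻¹ ^ s.card)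
    (t : ℕ) (x : V → EuclideanSpace ℝ (Fin d)) :
    ∫⁻ σ, (hkCount G ε δ t x (fun i => σ i) : ℝ≥0∞) ∂μ
      ≤ ENNReal.ofReal (Fintype.card V * L x) := by
  rw [lintegral_comp_restrict μ hiid fun w => (hkCount G ε δ t x w : ℝ≥0∞)]
  have hn : (0 : ℝ) < Fintype.card V := by exact_mod_cast Fintype.card_pos
  have h1 : ∑ w : Fin t → V, (hkCount G ε δ t x w : ℝ≥0∞)
      = ENNReal.ofReal (∑ w : Fin t → V, (hkCount G ε δ t x w : ℝ)) := by
    rw [ENNReal.ofReal_sum_of_nonneg fun _ _ => Nat.cast_nonneg _]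
    simp
  have h2 : ((Fintype.card V : ℝ≥0∞))⁻¹ ^ t
      = ENNReal.ofReal (((Fintype.card V : ℝ) ^ t)⁻¹) := by
    rw [ENNReal.ofReal_inv_of_pos (by positivity), ENNReal.ofReal_pow hn.le,
      ENNReal.ofReal_natCast, ENNReal.inv_pow]
  rw [h1, h2, ← ENNReal.ofReal_mul (by positivity)]
  refine ENNReal.ofReal_le_ofReal ?_
  rw [← div_eq_mul_inv, div_le_iff₀ (by positivity), mul_comm]
  exact sum_hkCount_le hL t x

theorem lintegral_sInf_hkStable_le {G : SimpleGraph V} {ε δ B : ℝ}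
    {L : (V → EuclideanSpace ℝ (Fin d)) → ℝ} (hL : IsHkLyapunov G ε δ B L)
    (μ : Measure (ℕ → V))
    (hiid : ∀ (s : Finset ℕ) (f : ℕ → V),
      μ {σ | ∀ i ∈ s, σ i = f i} = ((Fintype.card V : ℝ≥0∞))⁻¹ ^ s.card)
    (x : V → EuclideanSpace ℝ (Fin d)) :
    ∫⁻ σ, ((sInf {t : ℕ | hkStable G ε δ (hkTraj G ε x σ t)} : ℕ) : ℝ≥0∞) ∂μ
      ≤ ENNReal.ofReal (Fintype.card V * L x) := by
  have hpt : ∀ σ : ℕ → V, ((sInf {t : ℕ | hkStable G ε δ (hkTraj G ε x σ t)} : ℕ) : ℝ≥0∞)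
      ≤ Filter.liminf (fun t => (hkCount G ε δ t x (fun i => σ i) : ℝ≥0∞)) Filter.atTop := by
    intro σ
    refine Filter.le_liminf_of_le (by isBoundedDefault) ?_
    filter_upwards [Filter.eventually_ge_atTop
      (sInf {t : ℕ | hkStable G ε δ (hkTraj G ε x σ t)})] with t ht
    exact_mod_cast le_hkCount G ε δ ht x σ fun s hs => Nat.notMem_of_lt_sInf hs
  refine (lintegral_mono hpt).trans ?_
  refine (lintegral_liminf_le fun t =>
    measurable_comp_restrict fun w => (hkCount G ε δ t x w : ℝ≥0∞)).trans ?_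
  refine Filter.liminf_le_of_le (by isBoundedDefault) fun b hb => ?_
  obtain ⟨t, ht⟩ := hb.exists
  exact ht.trans (lintegral_hkCount_le hL μ hiid t x)

end HittingTime

/-- For a `d`-dimensional HKS with social network `G`, `n` agents and
uniform random asynchronous activations (iid uniform activation sequence), the
expected number of steps until a `δ`-stable state is reached is at most
`n·|E|²·ε²/(2δ²)`. -/
theorem hk_expected_convergence_time
    {d : ℕ} {V : Type*} [Fintype V] [DecidableEq V] [Nonempty V]
    [MeasurableSpace V] [MeasurableSingletonClass V]
    (G : SimpleGraph V) (ε δ : ℝ) (hε : 0 < ε) (hδ : 0 < δ) (hδε : δ < ε)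
    (x0 : V → EuclideanSpace ℝ (Fin d))
    (μ : Measure (ℕ → V)) [IsProbabilityMeasure μ]
    (hiid : ∀ (s : Finset ℕ) (f : ℕ → V),
      μ {σ | ∀ i ∈ s, σ i = f i} = ((Fintype.card V : ℝ≥0∞))⁻¹ ^ s.card) :
    ∫⁻ σ, ((sInf {t : ℕ | hkStable G ε δ (hkTraj G ε x0 σ t)} : ℕ) : ℝ≥0∞) ∂μ
      ≤ ENNReal.ofReal ((Fintype.card V : ℝ) * (G.edgeFinset.card : ℝ) ^ 2 * ε ^ 2
          / (2 * δ ^ 2)) := by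
  obtain ⟨L, hL⟩ := exists_lyapunov (d := d) G hε hδ hδε
  refine (lintegral_sInf_hkStable_le hL μ hiid x0).trans (ENNReal.ofReal_le_ofReal ?_)
  refine (mul_le_mul_of_nonneg_left (hL.le x0) (Nat.cast_nonneg _)).trans (le_of_eq ?_)
  ring
end

section
/- For the complete social network K_n, a d-dimensional HKS with uniform random asynchronous updates reaches a δ-stable state in expected time O(n³·(n² + (ε/δ)²)). In particular: (a) the expected number of steps during which some influence edge has length ≥ ε/2 is O(n⁵), and (b) while all influence edges are shorter than ε/2 (so each connected component of the influence network is a clique) but some edge has length ≥ δ, the expected potential drop per step is at least δ²/n. -/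
open MeasureTheory
open scoped Classical ENNReal

/-- The HKS potential `Φ(x) = ∑_{{u,v} ∈ E} min{‖x u − x v‖², ε²}`. -/
noncomputable def hkPotential {d : ℕ} {V : Type*} [Fintype V] [DecidableEq V]
    (G : SimpleGraph V) (ε : ℝ) (x : V → EuclideanSpace ℝ (Fin d)) : ℝ :=
  ∑ e ∈ G.edgeFinset,
    Sym2.lift ⟨fun a b => min (‖x a - x b‖ ^ 2) (ε ^ 2),
      fun a b => by simp [norm_sub_rev (x a)]⟩ e

/-- Parallel axis identity: the total squared distance to `a` splits into the total squared distance
to the centroid and the displacement of `a`. -/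
lemma sum_sq_norm_sub_centroid {E ι : Type*} [NormedAddCommGroup E] [InnerProductSpace ℝ E]
    (N : Finset ι) (hN : N.Nonempty) (x : ι → E) (a : E) :
    ∑ w ∈ N, ‖a - x w‖ ^ 2 =
      ∑ w ∈ N, ‖(N.card : ℝ)⁻¹ • ∑ u ∈ N, x u - x w‖ ^ 2 +
        N.card * ‖a - (N.card : ℝ)⁻¹ • ∑ u ∈ N, x u‖ ^ 2 := by
  set y := (N.card : ℝ)⁻¹ • ∑ u ∈ N, x u with hy
  have hk : (N.card : ℝ) ≠ 0 := by exact_mod_cast hN.card_ne_zero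
  have hsum : ∑ w ∈ N, (y - x w) = 0 := by
    rw [Finset.sum_sub_distrib, Finset.sum_const, ← Nat.cast_smul_eq_nsmul ℝ, hy,
      smul_inv_smul₀ hk, sub_self]
  have h : ∀ w, ‖a - x w‖ ^ 2 = ‖a - y‖ ^ 2 + 2 * inner ℝ (a - y) (y - x w) + ‖y - x w‖ ^ 2 := by
    intro w
    rw [← norm_add_sq_real, sub_add_sub_cancel]
  simp_rw [h, Finset.sum_add_distrib, ← Finset.mul_sum, ← inner_sum, hsum, inner_zero_right]
  simp
  ring

/-- The total outflow of a potential difference from a superlevel set along a symmetric relation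
dominates every single crossing pair. -/
lemma sub_le_sum_superlevel {V : Type*} [Fintype V] (r : V → V → Prop)
    (hr : ∀ a b, r a b → r b a) (f : V → ℝ) {u w : V} (huw : r u w) (h : f w < f u) :
    f u - f w ≤ ∑ v with f u ≤ f v, ∑ z with r v z, (f v - f z) := by
  set S : Finset V := {v | f u ≤ f v} with hS
  set g : V → V → ℝ := fun v z => if r v z then f v - f z else 0 with hg
  have hg_anti : ∀ a b, g a b = -g b a := by
    intro a b
    by_cases hab : r a b
    · simp [hg, hab, hr a b hab]
    · simp [hg, hab, show ¬ r b a from fun h' => hab (hr b a h')]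
  have hin : ∑ v ∈ S, ∑ z ∈ S, g v z = 0 := by
    have h1 : ∑ v ∈ S, ∑ z ∈ S, g v z = -∑ v ∈ S, ∑ z ∈ S, g v z := by
      conv_lhs => rw [Finset.sum_comm]
      simp_rw [← Finset.sum_neg_distrib]
      exact Finset.sum_congr rfl fun a _ => Finset.sum_congr rfl fun b _ => hg_anti b a
    linarith
  have hnn : ∀ v ∈ S, ∀ z ∈ Sᶜ, 0 ≤ g v z := by
    intro v hv z hz
    simp only [hS, Finset.mem_compl, Finset.mem_filter, Finset.mem_univ, true_and, not_le]
      at hv hz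
    simp only [hg]
    split_ifs
    · linarith
    · exact le_rfl
  have hu : u ∈ S := by simp [hS]
  have hw : w ∈ Sᶜ := by simp [hS, h]
  calc f u - f w = g u w := by simp [hg, huw]
    _ ≤ ∑ z ∈ Sᶜ, g u z := Finset.single_le_sum (f := g u) (hnn u hu) hw
    _ ≤ ∑ v ∈ S, ∑ z ∈ Sᶜ, g v z :=
      Finset.single_le_sum (f := fun v => ∑ z ∈ Sᶜ, g v z)
        (fun v hv => Finset.sum_nonneg (hnn v hv)) hu
    _ = ∑ v ∈ S, ∑ z ∈ S, g v z + ∑ v ∈ S, ∑ z ∈ Sᶜ, g v z := by rw [hin, zero_add]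
    _ = ∑ v ∈ S, ∑ z with r v z, (f v - f z) := by
      rw [← Finset.sum_add_distrib]
      refine Finset.sum_congr rfl fun v _ => ?_
      rw [Finset.sum_add_sum_compl, Finset.sum_filter]

section CompleteGraph

variable {d n : ℕ} {ε : ℝ}

lemma mem_hkNbhd_top {V : Type*} [Fintype V] [DecidableEq V] (hε : 0 ≤ ε)
    (x : V → EuclideanSpace ℝ (Fin d)) (v u : V) :
    u ∈ hkNbhd (⊤ : SimpleGraph V) ε x v ↔ ‖x v - x u‖ ≤ ε := by
  simp only [hkNbhd, Finset.mem_insert, Finset.mem_filter, Finset.mem_univ, true_and,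
    SimpleGraph.top_adj, norm_sub_rev (x v)]
  by_cases h : u = v
  · simp [h, hε]
  · simp [h]

lemma hkNbhd_nonempty {V : Type*} [Fintype V] [DecidableEq V] (G : SimpleGraph V)
    (x : V → EuclideanSpace ℝ (Fin d)) (v : V) : (hkNbhd G ε x v).Nonempty :=
  Finset.insert_nonempty _ _

lemma two_mul_hkPotential_top (x : Fin n → EuclideanSpace ℝ (Fin d)) :
    2 * hkPotential (⊤ : SimpleGraph (Fin n)) ε x =
      ∑ u, ∑ w, min (‖x u - x w‖ ^ 2) (ε ^ 2) := by
  have hmin : min (0 : ℝ) (ε ^ 2) = 0 := min_eq_left (sq_nonneg ε)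
  have h1 : hkPotential (⊤ : SimpleGraph (Fin n)) ε x =
      ∑ u, ∑ w, if u < w then min (‖x u - x w‖ ^ 2) (ε ^ 2) else 0 := by
    have hsum : hkPotential (⊤ : SimpleGraph (Fin n)) ε x =
        ∑ e ∈ (Finset.univ : Finset (Fin n)).sym2 with ¬ e.IsDiag,
          Sym2.lift ⟨fun a b => min (‖x a - x b‖ ^ 2) (ε ^ 2),
            fun a b => by simp [norm_sub_rev (x a)]⟩ e := by
      refine Finset.sum_congr ?_ fun _ _ => rfl
      ext e
      induction e with
      | _ a b => simp [SimpleGraph.mem_edgeFinset]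
    rw [hsum, Finset.sum_sym2_filter_not_isDiag, ← Finset.sum_product', ← Finset.sum_filter]
    refine Finset.sum_congr ?_ fun _ _ => rfl
    ext ⟨a, b⟩
    simp only [Finset.mem_filter, Finset.mem_offDiag, Finset.mem_univ, Finset.mem_product,
      true_and, and_iff_right_iff_imp]
    exact fun h => h.ne
  have h2 : hkPotential (⊤ : SimpleGraph (Fin n)) ε x =
      ∑ u, ∑ w, if w < u then min (‖x u - x w‖ ^ 2) (ε ^ 2) else 0 := by
    rw [h1, Finset.sum_comm]
    simp_rw [norm_sub_rev]
  rw [two_mul]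
  refine (congrArg₂ (· + ·) h1 h2).trans ?_
  simp_rw [← Finset.sum_add_distrib]
  refine Finset.sum_congr rfl fun u _ => Finset.sum_congr rfl fun w _ => ?_
  rcases lt_trichotomy u w with h | rfl | h
  · simp [h, h.not_gt]
  · simp [hmin]
  · simp [h, h.not_gt]

lemma hkPotential_top_nonneg (x : Fin n → EuclideanSpace ℝ (Fin d)) :
    0 ≤ hkPotential (⊤ : SimpleGraph (Fin n)) ε x := by
  have := two_mul_hkPotential_top (ε := ε) x
  have : 0 ≤ ∑ u, ∑ w, min (‖x u - x w‖ ^ 2) (ε ^ 2) := by positivity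
  linarith

lemma hkPotential_top_le (x : Fin n → EuclideanSpace ℝ (Fin d)) :
    hkPotential (⊤ : SimpleGraph (Fin n)) ε x ≤ n ^ 2 * ε ^ 2 / 2 := by
  have := two_mul_hkPotential_top (ε := ε) x
  have : ∑ u, ∑ w, min (‖x u - x w‖ ^ 2) (ε ^ 2) ≤ ∑ _u : Fin n, ∑ _w : Fin n, ε ^ 2 :=
    Finset.sum_le_sum fun _ _ => Finset.sum_le_sum fun _ _ => min_le_right _ _
  simp only [Finset.sum_const, Finset.card_univ, Fintype.card_fin, nsmul_eq_mul] at this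
  linarith

lemma hkPotential_top_sub_update (x : Fin n → EuclideanSpace ℝ (Fin d)) (v : Fin n)
    (y : EuclideanSpace ℝ (Fin d)) :
    hkPotential (⊤ : SimpleGraph (Fin n)) ε x -
        hkPotential (⊤ : SimpleGraph (Fin n)) ε (Function.update x v y) =
      ∑ w ∈ Finset.univ.erase v,
        (min (‖x v - x w‖ ^ 2) (ε ^ 2) - min (‖y - x w‖ ^ 2) (ε ^ 2)) := by
  set g : Fin n → Fin n → ℝ := fun a b => min (‖x a - x b‖ ^ 2) (ε ^ 2) -
    min (‖Function.update x v y a - Function.update x v y b‖ ^ 2) (ε ^ 2) with hg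
  have hsymm : ∀ a b, g a b = g b a := fun a b => by simp only [hg, norm_sub_rev]
  have hoff : ∀ a b, a ≠ v → b ≠ v → g a b = 0 := fun a b ha hb => by simp [hg, ha, hb]
  have hdiag : g v v = 0 := by simp [hg]
  have hrow : ∑ w, g v w = ∑ w ∈ Finset.univ.erase v,
      (min (‖x v - x w‖ ^ 2) (ε ^ 2) - min (‖y - x w‖ ^ 2) (ε ^ 2)) := by
    rw [← Finset.add_sum_erase _ _ (Finset.mem_univ v), hdiag, zero_add]
    refine Finset.sum_congr rfl fun w hw => ?_
    simp [hg, Finset.ne_of_mem_erase hw]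
  have hrest : ∑ u ∈ Finset.univ.erase v, ∑ w, g u w = ∑ w, g v w := by
    rw [← Finset.add_sum_erase _ (g v) (Finset.mem_univ v), hdiag, zero_add]
    refine Finset.sum_congr rfl fun u hu => ?_
    rw [Finset.sum_eq_single v (fun b _ hb => hoff u b (Finset.ne_of_mem_erase hu) hb)
      (by simp), hsymm]
  have htot : ∑ u, ∑ w, g u w = 2 * ∑ w, g v w := by
    rw [← Finset.add_sum_erase _ _ (Finset.mem_univ v), hrest, two_mul]
  simp only [hg, Finset.sum_sub_distrib] at htot
  rw [← hrow]
  simp only [hg, Finset.sum_sub_distrib]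
  have h1 := two_mul_hkPotential_top (ε := ε) x
  have h2 := two_mul_hkPotential_top (ε := ε) (Function.update x v y)
  linarith

/-- Moving `v` to the centroid of its neighborhood decreases the potential by at least the squared
displacement times the neighborhood size plus one. -/
lemma le_hkPotential_top_sub_hkStep (hε : 0 ≤ ε) (x : Fin n → EuclideanSpace ℝ (Fin d))
    (v : Fin n) :
    ((hkNbhd (⊤ : SimpleGraph (Fin n)) ε x v).card + 1) *
        ‖x v - hkStep (⊤ : SimpleGraph (Fin n)) ε x v v‖ ^ 2 ≤
      hkPotential (⊤ : SimpleGraph (Fin n)) ε x -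
        hkPotential (⊤ : SimpleGraph (Fin n)) ε (hkStep (⊤ : SimpleGraph (Fin n)) ε x v) := by
  set N := hkNbhd (⊤ : SimpleGraph (Fin n)) ε x v with hN
  set y := (N.card : ℝ)⁻¹ • ∑ u ∈ N, x u with hy
  have hstep : hkStep (⊤ : SimpleGraph (Fin n)) ε x v = Function.update x v y := rfl
  have hvN : v ∈ N := Finset.mem_insert_self _ _
  have key := sum_sq_norm_sub_centroid N ⟨v, hvN⟩ x (x v)
  rw [← hy, ← Finset.add_sum_erase _ _ hvN, ← Finset.add_sum_erase N _ hvN, sub_self, norm_zero,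
    norm_sub_rev y (x v)] at key
  have hsub : N.erase v ⊆ Finset.univ.erase v := Finset.erase_subset_erase _ (Finset.subset_univ _)
  have hle : ∑ w ∈ N.erase v, (‖x v - x w‖ ^ 2 - ‖y - x w‖ ^ 2) ≤
      ∑ w ∈ Finset.univ.erase v,
        (min (‖x v - x w‖ ^ 2) (ε ^ 2) - min (‖y - x w‖ ^ 2) (ε ^ 2)) := by
    refine (Finset.sum_le_sum fun w hw => ?_).trans
      (Finset.sum_le_sum_of_subset_of_nonneg hsub fun w hw hw' => ?_)
    · have h := (mem_hkNbhd_top hε x v w).1 (Finset.mem_of_mem_erase hw)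
      rw [min_eq_left (pow_le_pow_left₀ (norm_nonneg _) h 2)]
      exact sub_le_sub_left (min_le_left _ _) _
    · have h : ¬ ‖x v - x w‖ ≤ ε := fun h =>
        hw' (Finset.mem_erase.2 ⟨Finset.ne_of_mem_erase hw, (mem_hkNbhd_top hε x v w).2 h⟩)
      rw [min_eq_right (pow_le_pow_left₀ hε (not_le.1 h).le 2)]
      exact sub_nonneg.2 (min_le_right _ _)
  rw [Finset.sum_sub_distrib] at hle
  rw [hstep, hkPotential_top_sub_update, Function.update_self]
  linarith

lemma hkPotential_top_hkStep_le (hε : 0 ≤ ε) (x : Fin n → EuclideanSpace ℝ (Fin d)) (v : Fin n) :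
    hkPotential (⊤ : SimpleGraph (Fin n)) ε (hkStep (⊤ : SimpleGraph (Fin n)) ε x v) ≤
      hkPotential (⊤ : SimpleGraph (Fin n)) ε x :=
  sub_nonneg.1 ((by positivity : (0 : ℝ) ≤ _).trans (le_hkPotential_top_sub_hkStep hε x v))

/-- The degree-weighted movements of all agents dominate the length of any influence edge. -/
lemma norm_sub_le_sum_card_mul_norm (hε : 0 ≤ ε) (x : Fin n → EuclideanSpace ℝ (Fin d))
    {u w : Fin n} (huw : ‖x u - x w‖ ≤ ε) :
    ‖x u - x w‖ ≤ ∑ v, ((hkNbhd (⊤ : SimpleGraph (Fin n)) ε x v).card : ℝ) *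
      ‖x v - hkStep (⊤ : SimpleGraph (Fin n)) ε x v v‖ := by
  rcases eq_or_ne (x u - x w) 0 with h0 | h0
  · rw [h0, norm_zero]
    positivity
  set e := x u - x w with he
  have hpos : 0 < ‖e‖ := norm_pos_iff.2 h0
  have hdiff : inner ℝ e (x u) - inner ℝ e (x w) = ‖e‖ * ‖e‖ := by
    rw [← inner_sub_right, ← he, real_inner_self_eq_norm_mul_norm]
  have hcut := sub_le_sum_superlevel (fun a b => ‖x a - x b‖ ≤ ε)
    (fun a b h => by rwa [norm_sub_rev]) (fun v => inner ℝ e (x v)) huw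
    (sub_pos.1 (hdiff ▸ mul_pos hpos hpos))
  rw [hdiff] at hcut
  have hterm : ∀ v : Fin n, ∑ z with ‖x v - x z‖ ≤ ε, (inner ℝ e (x v) - inner ℝ e (x z)) ≤
      ‖e‖ * (((hkNbhd (⊤ : SimpleGraph (Fin n)) ε x v).card : ℝ) *
        ‖x v - hkStep (⊤ : SimpleGraph (Fin n)) ε x v v‖) := by
    intro v
    have hset : ({z | ‖x v - x z‖ ≤ ε} : Finset (Fin n)) =
        hkNbhd (⊤ : SimpleGraph (Fin n)) ε x v := by
      ext z
      simp [mem_hkNbhd_top hε]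
    rw [hset]
    set N := hkNbhd (⊤ : SimpleGraph (Fin n)) ε x v with hN
    have hk : (N.card : ℝ) ≠ 0 := by exact_mod_cast (hkNbhd_nonempty _ x v).card_ne_zero
    have hmove : ∑ z ∈ N, (x v - x z) =
        (N.card : ℝ) • (x v - hkStep (⊤ : SimpleGraph (Fin n)) ε x v v) := by
      rw [hkStep, Function.update_self, smul_sub, smul_inv_smul₀ hk, Finset.sum_sub_distrib,
        Finset.sum_const, Nat.cast_smul_eq_nsmul]
    simp_rw [← inner_sub_right]
    rw [← inner_sum, hmove]
    refine (real_inner_le_norm _ _).trans_eq ?_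
    rw [norm_smul, Real.norm_natCast]
  refine le_of_mul_le_mul_left ?_ hpos
  rw [Finset.mul_sum]
  refine hcut.trans ((Finset.sum_le_sum fun v _ => hterm v).trans ?_)
  exact Finset.sum_le_sum_of_subset_of_nonneg (Finset.subset_univ _) fun _ _ _ => by positivity

/-- The total potential drop over all agents is at least `λ² / n²` for any influence edge of
length `λ`. -/
lemma sq_norm_sub_le_mul_sum_drop (hε : 0 ≤ ε) (x : Fin n → EuclideanSpace ℝ (Fin d))
    {u w : Fin n} (huw : ‖x u - x w‖ ≤ ε) :
    ‖x u - x w‖ ^ 2 ≤ n ^ 2 * ∑ v, (hkPotential (⊤ : SimpleGraph (Fin n)) ε x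
      - hkPotential (⊤ : SimpleGraph (Fin n)) ε (hkStep (⊤ : SimpleGraph (Fin n)) ε x v)) := by
  set k : Fin n → ℝ := fun v => (hkNbhd (⊤ : SimpleGraph (Fin n)) ε x v).card with hk
  set m : Fin n → ℝ := fun v => ‖x v - hkStep (⊤ : SimpleGraph (Fin n)) ε x v v‖ with hm
  have hk0 : ∀ v, 0 ≤ k v := fun v => Nat.cast_nonneg _
  have hkn : ∑ v, k v ≤ n ^ 2 := by
    have : ∑ v, k v ≤ ∑ _v : Fin n, (n : ℝ) := Finset.sum_le_sum fun v _ => by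
      have := Finset.card_le_univ (hkNbhd (⊤ : SimpleGraph (Fin n)) ε x v)
      rw [Fintype.card_fin] at this
      exact Nat.cast_le.2 this
    simpa [sq] using this
  calc ‖x u - x w‖ ^ 2 ≤ (∑ v, k v * m v) ^ 2 :=
        pow_le_pow_left₀ (norm_nonneg _) (norm_sub_le_sum_card_mul_norm hε x huw) 2
    _ ≤ (∑ v, k v) * ∑ v, k v * m v ^ 2 :=
        Finset.sum_sq_le_sum_mul_sum_of_sq_le_mul _ (fun v _ => hk0 v)
          (fun v _ => mul_nonneg (hk0 v) (sq_nonneg _)) (fun v _ => le_of_eq (by ring))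
    _ ≤ _ := by
        refine mul_le_mul hkn (Finset.sum_le_sum fun v _ => ?_)
          (Finset.sum_nonneg fun v _ => mul_nonneg (hk0 v) (sq_nonneg _)) (by positivity)
        refine le_trans ?_ (le_hkPotential_top_sub_hkStep hε x v)
        exact mul_le_mul_of_nonneg_right (le_add_of_nonneg_right zero_le_one) (sq_nonneg _)

/-- If all influence edges are shorter than `ε / 2`, the influence components are cliques and the
total potential drop over all agents is at least the squared length of any influence edge. -/
lemma sq_norm_sub_le_sum_drop (hε : 0 ≤ ε) (x : Fin n → EuclideanSpace ℝ (Fin d))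
    (hshort : ∀ u w : Fin n, u ≠ w → ‖x u - x w‖ ≤ ε → ‖x u - x w‖ < ε / 2)
    {u w : Fin n} (hne : u ≠ w) (huw : ‖x u - x w‖ ≤ ε) :
    ‖x u - x w‖ ^ 2 ≤ ∑ v, (hkPotential (⊤ : SimpleGraph (Fin n)) ε x
      - hkPotential (⊤ : SimpleGraph (Fin n)) ε (hkStep (⊤ : SimpleGraph (Fin n)) ε x v)) := by
  have hhalf : ∀ a b, ‖x a - x b‖ ≤ ε → ‖x a - x b‖ ≤ ε / 2 := by
    intro a b hab
    rcases eq_or_ne a b with rfl | h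
    · simpa using div_nonneg hε zero_le_two
    · exact (hshort a b h hab).le
  have htrans : ∀ a b c, ‖x a - x b‖ ≤ ε → ‖x b - x c‖ ≤ ε → ‖x a - x c‖ ≤ ε := by
    intro a b c hab hbc
    have := norm_sub_le_norm_sub_add_norm_sub (x a) (x b) (x c)
    linarith [hhalf a b hab, hhalf b c hbc]
  have hN : hkNbhd (⊤ : SimpleGraph (Fin n)) ε x w = hkNbhd (⊤ : SimpleGraph (Fin n)) ε x u := by
    ext z
    rw [mem_hkNbhd_top hε, mem_hkNbhd_top hε]
    exact ⟨htrans u w z huw, htrans w u z (by rwa [norm_sub_rev])⟩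
  have hmean : hkStep (⊤ : SimpleGraph (Fin n)) ε x w w =
      hkStep (⊤ : SimpleGraph (Fin n)) ε x u u := by
    rw [hkStep, hkStep, Function.update_self, Function.update_self, hN]
  have hcard : ∀ v, (1 : ℝ) ≤ (hkNbhd (⊤ : SimpleGraph (Fin n)) ε x v).card := fun v => by
    exact_mod_cast (hkNbhd_nonempty _ x v).card_pos
  have hdrop : ∀ v, 2 * ‖x v - hkStep (⊤ : SimpleGraph (Fin n)) ε x v v‖ ^ 2 ≤
      hkPotential (⊤ : SimpleGraph (Fin n)) ε x -
        hkPotential (⊤ : SimpleGraph (Fin n)) ε (hkStep (⊤ : SimpleGraph (Fin n)) ε x v) :=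
    fun v => (mul_le_mul_of_nonneg_right (by linarith [hcard v]) (sq_nonneg _)).trans
      (le_hkPotential_top_sub_hkStep hε x v)
  have hpair := Finset.sum_le_sum_of_subset_of_nonneg (Finset.subset_univ {u, w})
    fun v _ _ => sub_nonneg.2 (hkPotential_top_hkStep_le hε x v)
  rw [Finset.sum_pair hne] at hpair
  have hu := hdrop u
  have hw := hdrop w
  rw [hmean] at hw
  have htri := norm_sub_le_norm_sub_add_norm_sub (x u) (hkStep (⊤ : SimpleGraph (Fin n)) ε x u u)
    (x w)
  rw [norm_sub_rev (hkStep _ _ _ _ _) (x w)] at htri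
  nlinarith [sq_nonneg (‖x u - hkStep (⊤ : SimpleGraph (Fin n)) ε x u u‖ -
    ‖x w - hkStep (⊤ : SimpleGraph (Fin n)) ε x u u‖), norm_nonneg (x u - x w)]

end CompleteGraph

/-- Law of the activated agent given the past, for uniform independent activations: a function of
the first `t` activations and the current one may be averaged over the current one. -/
lemma lintegral_prefix_next {n : ℕ} (μ : Measure (ℕ → Fin n)) [IsProbabilityMeasure μ]
    (hμ : ∀ (s : Finset ℕ) (f : ℕ → Fin n),
      μ {σ | ∀ i ∈ s, σ i = f i} = ((n : ℝ≥0∞))⁻¹ ^ s.card)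
    (t : ℕ) (H : (Fin t → Fin n) → Fin n → ℝ≥0∞) :
    ∫⁻ σ, H (fun i => σ i) (σ t) ∂μ =
      ∫⁻ σ, (n : ℝ≥0∞)⁻¹ * ∑ v, H (fun i => σ i) v ∂μ := by
  have hpre : Measurable fun σ : ℕ → Fin n => (fun i : Fin t => σ i) := by fun_prop
  have hpair : Measurable fun σ : ℕ → Fin n => ((fun i : Fin t => σ i), σ t) := by fun_prop
  have hμpre : ∀ w : Fin t → Fin n,
      μ.map (fun σ => (fun i : Fin t => σ i)) {w} = (n : ℝ≥0∞)⁻¹ ^ t := by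
    intro w
    rw [Measure.map_apply hpre (measurableSet_singleton _)]
    rcases isEmpty_or_nonempty (ℕ → Fin n) with hE | ⟨⟨f⟩⟩
    · exact absurd (measure_univ (μ := μ)) (by simp [Set.eq_empty_of_isEmpty])
    · have h := hμ (Finset.range t) (fun i => if hi : i < t then w ⟨i, hi⟩ else f i)
      rw [Finset.card_range] at h
      rw [← h]
      congr 1
      ext σ
      simp only [Set.mem_preimage, Set.mem_singleton_iff, funext_iff, Set.mem_ofPred_eq,
        Finset.mem_range]
      exact ⟨fun h i hi => by simpa [hi] using h ⟨i, hi⟩, fun h i => by simpa using h i i.2⟩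
  have hμpair : ∀ p : (Fin t → Fin n) × Fin n,
      μ.map (fun σ => ((fun i : Fin t => σ i), σ t)) {p} = (n : ℝ≥0∞)⁻¹ ^ (t + 1) := by
    rintro ⟨w, v⟩
    rw [Measure.map_apply hpair (measurableSet_singleton _)]
    have h := hμ (Finset.range (t + 1)) (fun i => if hi : i < t then w ⟨i, hi⟩ else v)
    rw [Finset.card_range] at h
    rw [← h]
    congr 1
    ext σ
    simp only [Set.mem_preimage, Set.mem_singleton_iff, Prod.mk.injEq, funext_iff,
      Set.mem_ofPred_eq, Finset.mem_range]
    refine ⟨fun h i hi => ?_, fun h => ⟨fun i => ?_, ?_⟩⟩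
    · rcases Nat.lt_succ_iff_lt_or_eq.1 hi with hi | rfl
      · simpa [hi] using h.1 ⟨i, hi⟩
      · simpa using h.2
    · simpa using h i (i.2.trans (Nat.lt_succ_self t))
    · simpa using h t (Nat.lt_succ_self t)
  calc ∫⁻ σ, H (fun i => σ i) (σ t) ∂μ
      = ∫⁻ p, H p.1 p.2 ∂μ.map (fun σ => ((fun i : Fin t => σ i), σ t)) :=
        (lintegral_map (f := fun p : (Fin t → Fin n) × Fin n => H p.1 p.2)
          (measurable_of_finite _) hpair).symm
    _ = ∑ w, ((n : ℝ≥0∞)⁻¹ * ∑ v, H w v) * (n : ℝ≥0∞)⁻¹ ^ t := by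
        rw [lintegral_fintype, Fintype.sum_prod_type]
        refine Finset.sum_congr rfl fun w _ => ?_
        simp_rw [hμpair, ← Finset.sum_mul]
        ring
    _ = ∫⁻ w, (n : ℝ≥0∞)⁻¹ * ∑ v, H w v ∂μ.map (fun σ => (fun i : Fin t => σ i)) := by
        rw [lintegral_fintype]
        simp_rw [hμpre]
    _ = _ := lintegral_map (measurable_of_finite _) hpre

lemma hkTraj_eq_foldl {d : ℕ} {V : Type*} [Fintype V] [DecidableEq V] (G : SimpleGraph V) (ε : ℝ)
    (x0 : V → EuclideanSpace ℝ (Fin d)) (σ : ℕ → V) (t : ℕ) :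
    hkTraj G ε x0 σ t = (List.ofFn fun i : Fin t => σ i).foldl (hkStep G ε) x0 := by
  induction t with
  | zero => simp [hkTraj]
  | succ t ih => rw [hkTraj, ih, List.ofFn_succ_last, List.foldl_append]; rfl

/-- Any function of the state at time `t` is measurable, as it depends on finitely many
activations. -/
lemma measurable_comp_hkTraj {d n : ℕ} {β : Type*} [MeasurableSpace β]
    (G : SimpleGraph (Fin n)) (ε : ℝ) (x0 : Fin n → EuclideanSpace ℝ (Fin d)) (t : ℕ)
    (F : (Fin n → EuclideanSpace ℝ (Fin d)) → β) :
    Measurable fun σ : ℕ → Fin n => F (hkTraj G ε x0 σ t) := by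
  simp_rw [hkTraj_eq_foldl]
  exact (measurable_of_finite fun w : Fin t → Fin n =>
    F ((List.ofFn w).foldl (hkStep G ε) x0)).comp
    (g := fun w : Fin t → Fin n => F ((List.ofFn w).foldl (hkStep G ε) x0))
    (f := fun (σ : ℕ → Fin n) (i : Fin t) => σ i) (by fun_prop)

/-- Drift argument: if a nonnegative potential never increases on average and drops by at least `c`
on average in every state satisfying `P`, then the expected number of visits to `P` is at most the
initial potential divided by `c`. -/
lemma lintegral_tsum_visits_le {d n : ℕ} (hn : 0 < n) (G : SimpleGraph (Fin n)) (ε : ℝ)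
    (x0 : Fin n → EuclideanSpace ℝ (Fin d)) (μ : Measure (ℕ → Fin n)) [IsProbabilityMeasure μ]
    (hμ : ∀ (s : Finset ℕ) (f : ℕ → Fin n),
      μ {σ | ∀ i ∈ s, σ i = f i} = ((n : ℝ≥0∞))⁻¹ ^ s.card)
    (Φ : (Fin n → EuclideanSpace ℝ (Fin d)) → ℝ) (hΦ : ∀ x, 0 ≤ Φ x)
    (P : (Fin n → EuclideanSpace ℝ (Fin d)) → Prop) {c : ℝ} (hc : 0 < c)
    (hdrift : ∀ x, (if P x then c else 0) ≤ (n : ℝ)⁻¹ * ∑ v, (Φ x - Φ (hkStep G ε x v))) :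
    ∫⁻ σ, ∑' t : ℕ, (if P (hkTraj G ε x0 σ t) then (1 : ℝ≥0∞) else 0) ∂μ ≤
      ENNReal.ofReal (Φ x0 / c) := by
  have hn0 : (0 : ℝ) < n := by exact_mod_cast hn
  have hpoint : ∀ x, (n : ℝ≥0∞)⁻¹ * ∑ v, ENNReal.ofReal (Φ (hkStep G ε x v)) +
      ENNReal.ofReal c * (if P x then 1 else 0) ≤ ENNReal.ofReal (Φ x) := by
    intro x
    have h1 : (n : ℝ≥0∞)⁻¹ * ∑ v, ENNReal.ofReal (Φ (hkStep G ε x v)) =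
        ENNReal.ofReal ((n : ℝ)⁻¹ * ∑ v, Φ (hkStep G ε x v)) := by
      rw [ENNReal.ofReal_mul (by positivity), ENNReal.ofReal_inv_of_pos hn0,
        ENNReal.ofReal_natCast, ENNReal.ofReal_sum_of_nonneg fun v _ => hΦ _]
    have h2 : ENNReal.ofReal c * (if P x then 1 else 0) =
        ENNReal.ofReal (if P x then c else 0) := by
      split_ifs <;> simp
    have h3 : (0 : ℝ) ≤ if P x then c else 0 := by split_ifs <;> linarith
    rw [h1, h2, ← ENNReal.ofReal_add
      (mul_nonneg (by positivity) (Finset.sum_nonneg fun v _ => hΦ _)) h3]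
    refine ENNReal.ofReal_le_ofReal ?_
    have h4 := hdrift x
    rw [Finset.sum_sub_distrib, Finset.sum_const, Finset.card_univ, Fintype.card_fin,
      nsmul_eq_mul, mul_sub, inv_mul_cancel_left₀ hn0.ne'] at h4
    linarith
  have hstep : ∀ t, ∫⁻ σ, ENNReal.ofReal (Φ (hkTraj G ε x0 σ (t + 1))) ∂μ +
      ENNReal.ofReal c * ∫⁻ σ, (if P (hkTraj G ε x0 σ t) then 1 else 0) ∂μ ≤
      ∫⁻ σ, ENNReal.ofReal (Φ (hkTraj G ε x0 σ t)) ∂μ := by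
    intro t
    have h1 : ∫⁻ σ, ENNReal.ofReal (Φ (hkTraj G ε x0 σ (t + 1))) ∂μ =
        ∫⁻ σ, (n : ℝ≥0∞)⁻¹ *
          ∑ v, ENNReal.ofReal (Φ (hkStep G ε (hkTraj G ε x0 σ t) v)) ∂μ := by
      simp only [hkTraj, hkTraj_eq_foldl]
      exact lintegral_prefix_next μ hμ t fun w v =>
        ENNReal.ofReal (Φ (hkStep G ε ((List.ofFn w).foldl (hkStep G ε) x0) v))
    rw [h1, ← lintegral_const_mul _
      (measurable_comp_hkTraj G ε x0 t fun x => if P x then (1 : ℝ≥0∞) else 0),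
      ← lintegral_add_left (measurable_comp_hkTraj G ε x0 t fun x =>
        (n : ℝ≥0∞)⁻¹ * ∑ v, ENNReal.ofReal (Φ (hkStep G ε x v)))]
    exact lintegral_mono fun σ => hpoint _
  have hsum : ∀ T, ∫⁻ σ, ENNReal.ofReal (Φ (hkTraj G ε x0 σ T)) ∂μ + ENNReal.ofReal c *
      ∑ t ∈ Finset.range T, ∫⁻ σ, (if P (hkTraj G ε x0 σ t) then 1 else 0) ∂μ ≤
      ENNReal.ofReal (Φ x0) := by
    intro T
    induction T with
    | zero => simp [hkTraj]
    | succ T ih =>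
      refine le_trans ?_ ih
      rw [Finset.sum_range_succ, mul_add, add_comm (ENNReal.ofReal c * _), ← add_assoc]
      exact add_le_add_left (hstep T) _
  rw [lintegral_tsum fun t => (measurable_comp_hkTraj G ε x0 t
    fun x => if P x then (1 : ℝ≥0∞) else 0).aemeasurable]
  refine ENNReal.tsum_le_of_sum_range_le fun T => ?_
  rw [ENNReal.ofReal_div_of_pos hc, ENNReal.le_div_iff_mul_le (by simp [hc]) (by simp), mul_comm]
  exact le_add_self.trans (hsum T)

/-- The first time `t` at which `Q t` holds is at most the number of times at which it fails. -/
lemma natCast_sInf_le_tsum_not (Q : ℕ → Prop) :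
    ((sInf {t | Q t} : ℕ) : ℝ≥0∞) ≤ ∑' t, if ¬ Q t then 1 else 0 := by
  have h : ∀ t ∈ Finset.range (sInf {t | Q t}), (if ¬ Q t then 1 else 0 : ℝ≥0∞) = 1 :=
    fun t ht => if_pos (Nat.notMem_of_lt_sInf (Finset.mem_range.1 ht))
  calc ((sInf {t | Q t} : ℕ) : ℝ≥0∞)
      = ∑ t ∈ Finset.range (sInf {t | Q t}), if ¬ Q t then 1 else 0 := by
        rw [Finset.sum_congr rfl h]
        simp
    _ ≤ _ := ENNReal.sum_le_tsum _

/-- For the complete social network `K_n`, a `d`-dimensional HKS with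
uniform random asynchronous updates reaches a `δ`-stable state in expected time
`O(n³·(n² + (ε/δ)²))`. In particular, (a) the expected number of steps with some
influence edge of length at least `ε/2` is `O(n⁵)`, and (b) while all influence
edges are shorter than `ε/2` but some influence edge has length at least `δ`, the
expected potential drop per step is at least `δ²/n`. -/
theorem complete_network_convergence :
    ∃ C : ℝ, 0 < C ∧
      ∀ (d n : ℕ), 0 < n → ∀ (ε δ : ℝ), 0 < δ → δ < ε →
        ∀ (x0 : Fin n → EuclideanSpace ℝ (Fin d))
          (μ : Measure (ℕ → Fin n)), IsProbabilityMeasure μ →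
          (∀ (s : Finset ℕ) (f : ℕ → Fin n),
            μ {σ | ∀ i ∈ s, σ i = f i} = ((n : ℝ≥0∞))⁻¹ ^ s.card) →
          -- main bound: expected convergence time O(n³(n² + (ε/δ)²))
          ((∫⁻ σ, ((sInf {t : ℕ |
              hkStable (⊤ : SimpleGraph (Fin n)) ε δ
                (hkTraj (⊤ : SimpleGraph (Fin n)) ε x0 σ t)} : ℕ) : ℝ≥0∞) ∂μ)
            ≤ ENNReal.ofReal (C * (n : ℝ) ^ 3 * ((n : ℝ) ^ 2 + (ε / δ) ^ 2))) ∧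
          -- (a) expected number of steps with an influence edge of length ≥ ε/2
          ((∫⁻ σ, (∑' t : ℕ,
              if ∃ u w : Fin n, u ≠ w ∧
                  ‖hkTraj (⊤ : SimpleGraph (Fin n)) ε x0 σ t u
                    - hkTraj (⊤ : SimpleGraph (Fin n)) ε x0 σ t w‖ ≤ ε ∧
                  ε / 2 ≤ ‖hkTraj (⊤ : SimpleGraph (Fin n)) ε x0 σ t u
                    - hkTraj (⊤ : SimpleGraph (Fin n)) ε x0 σ t w‖
                then (1 : ℝ≥0∞) else 0) ∂μ)
            ≤ ENNReal.ofReal (C * (n : ℝ) ^ 5)) ∧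
          -- (b) per-step expected potential drop in the short-edge regime
          (∀ x : Fin n → EuclideanSpace ℝ (Fin d),
            (∀ u w : Fin n, u ≠ w → ‖x u - x w‖ ≤ ε → ‖x u - x w‖ < ε / 2) →
            (∃ u w : Fin n, u ≠ w ∧ ‖x u - x w‖ ≤ ε ∧ δ ≤ ‖x u - x w‖) →
            (n : ℝ)⁻¹ * ∑ v, (hkPotential (⊤ : SimpleGraph (Fin n)) ε x
                - hkPotential (⊤ : SimpleGraph (Fin n)) ε
                    (hkStep (⊤ : SimpleGraph (Fin n)) ε x v))
              ≥ δ ^ 2 / (n : ℝ)) := by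
  refine ⟨2, two_pos, fun d n hn ε δ hδ hδε x0 μ _ hμ => ?_⟩
  have hε : 0 < ε := hδ.trans hδε
  have hn0 : (0 : ℝ) < n := Nat.cast_pos.2 hn
  set Φ : (Fin n → EuclideanSpace ℝ (Fin d)) → ℝ := hkPotential (⊤ : SimpleGraph (Fin n)) ε
    with hΦ
  set drop : (Fin n → EuclideanSpace ℝ (Fin d)) → ℝ := fun x =>
    (n : ℝ)⁻¹ * ∑ v, (Φ x - Φ (hkStep (⊤ : SimpleGraph (Fin n)) ε x v)) with hdrop
  have drop_nonneg : ∀ x, 0 ≤ drop x := fun x => mul_nonneg (by positivity)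
    (Finset.sum_nonneg fun v _ => sub_nonneg.2 (hkPotential_top_hkStep_le hε.le x v))
  have drop_long : ∀ x : Fin n → EuclideanSpace ℝ (Fin d), (∃ u w : Fin n, u ≠ w ∧
      ‖x u - x w‖ ≤ ε ∧ ε / 2 ≤ ‖x u - x w‖) → ε ^ 2 / (4 * n ^ 3) ≤ drop x := by
    rintro x ⟨u, w, -, h1, h2⟩
    have h3 := sq_norm_sub_le_mul_sum_drop hε.le x h1
    have h4 : (ε / 2) ^ 2 ≤ ‖x u - x w‖ ^ 2 := pow_le_pow_left₀ (by positivity) h2 2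
    have h5 : (ε / 2) ^ 2 ≤ n ^ 3 * drop x := by
      refine (h4.trans h3).trans_eq ?_
      simp only [hdrop, hΦ]
      field_simp
    rw [div_le_iff₀ (by positivity)]
    linarith
  have drop_short : ∀ x : Fin n → EuclideanSpace ℝ (Fin d),
      (∀ u w : Fin n, u ≠ w → ‖x u - x w‖ ≤ ε → ‖x u - x w‖ < ε / 2) →
      (∃ u w : Fin n, u ≠ w ∧ ‖x u - x w‖ ≤ ε ∧ δ ≤ ‖x u - x w‖) → δ ^ 2 / n ≤ drop x := by
    rintro x hshort ⟨u, w, hne, h1, h2⟩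
    have h3 := sq_norm_sub_le_sum_drop hε.le x hshort hne h1
    have h4 : δ ^ 2 ≤ ‖x u - x w‖ ^ 2 := pow_le_pow_left₀ hδ.le h2 2
    rw [div_eq_inv_mul]
    exact mul_le_mul_of_nonneg_left (h4.trans h3) (by positivity)
  have hΦx0 : Φ x0 ≤ n ^ 2 * ε ^ 2 / 2 := hkPotential_top_le x0
  refine ⟨?_, ?_, drop_short⟩
  · set c : ℝ := (4 * n ^ 3 / ε ^ 2 + n / δ ^ 2)⁻¹ with hc
    have hc0 : 0 < c := by positivity
    have hc_long : c ≤ ε ^ 2 / (4 * n ^ 3) := by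
      rw [← inv_div (4 * (n : ℝ) ^ 3) (ε ^ 2)]
      exact inv_anti₀ (by positivity) (le_add_of_nonneg_right (by positivity))
    have hc_short : c ≤ δ ^ 2 / n := by
      rw [← inv_div (n : ℝ) (δ ^ 2)]
      exact inv_anti₀ (by positivity) (le_add_of_nonneg_left (by positivity))
    have hvisits := lintegral_tsum_visits_le hn (⊤ : SimpleGraph (Fin n)) ε x0 μ hμ Φ
      hkPotential_top_nonneg (fun x => ¬ hkStable (⊤ : SimpleGraph (Fin n)) ε δ x) hc0 (by
        intro x
        split_ifs with hP
        · exact drop_nonneg x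
        · simp only [hkStable, SimpleGraph.top_adj, not_forall, not_le] at hP
          obtain ⟨u, w, hne, h1, h2⟩ := hP
          by_cases hlong : ∃ u w : Fin n, u ≠ w ∧ ‖x u - x w‖ ≤ ε ∧ ε / 2 ≤ ‖x u - x w‖
          · exact hc_long.trans (drop_long x hlong)
          · push Not at hlong
            exact hc_short.trans (drop_short x hlong ⟨u, w, hne, h1, h2.le⟩))
    refine (lintegral_mono fun σ => ?_).trans
      (hvisits.trans (ENNReal.ofReal_le_ofReal ?_))
    · convert natCast_sInf_le_tsum_not _
    · rw [hc, div_inv_eq_mul]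
      calc Φ x0 * (4 * n ^ 3 / ε ^ 2 + n / δ ^ 2)
          ≤ n ^ 2 * ε ^ 2 / 2 * (4 * n ^ 3 / ε ^ 2 + n / δ ^ 2) :=
            mul_le_mul_of_nonneg_right hΦx0 (by positivity)
        _ = 2 * n ^ 3 * n ^ 2 + n ^ 3 * (ε / δ) ^ 2 / 2 := by field_simp; ring
        _ ≤ 2 * n ^ 3 * (n ^ 2 + (ε / δ) ^ 2) := by
            have : 0 ≤ (n : ℝ) ^ 3 * (ε / δ) ^ 2 := by positivity
            linarith
  · have hvisits := lintegral_tsum_visits_le hn (⊤ : SimpleGraph (Fin n)) ε x0 μ hμ Φ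
      hkPotential_top_nonneg (fun x => ∃ u w : Fin n, u ≠ w ∧
        ‖x u - x w‖ ≤ ε ∧ ε / 2 ≤ ‖x u - x w‖) (c := ε ^ 2 / (4 * n ^ 3)) (by positivity) (by
        intro x
        split_ifs with hP
        · exact drop_long x hP
        · exact drop_nonneg x)
    refine le_trans (le_of_eq ?_) (hvisits.trans (ENNReal.ofReal_le_ofReal ?_))
    · congr!
    · calc Φ x0 / (ε ^ 2 / (4 * n ^ 3)) ≤ n ^ 2 * ε ^ 2 / 2 / (ε ^ 2 / (4 * n ^ 3)) :=
            div_le_div_of_nonneg_right hΦx0 (by positivity)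
        _ = 2 * n ^ 5 := by field_simp; ring
end
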